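/- arXiv:2305.08716 — 6 statements merged into one kernel-verified Lean document; each statement's English description precedes it below -/
import Mathlib

section
/- For all integers d ≥ 2 and k ≥ 1, there exists a linear stacked d-sphere S on (3d+8)k vertices whose transversal number satisfies τ(S) ≥ 6k. -/
open Finset

/-- `τ` is a face of the partial stacked ball built from the first `k` simplices of `σ`. -/
def memBall {m : ℕ} (σ : Fin m → Finset ℕ) (k : ℕ) (τ : Finset ℕ) : Prop :=
  ∃ i : Fin m, i.val < k ∧ τ ⊆ σ i

/-- `σ` is a construction sequence `Γ(B) = (σ₁, …, σ_m)` of a stacked `(d+1)`-ball `B`: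
each `σ i` is a `(d+2)`-element vertex set (a `(d+1)`-simplex), and each `σ k` (`k > 0`)
is glued to the previously built ball `B_k` along a `(d+1)`-element free face `η` of
`B_k` (a face lying in a unique maximal face), i.e. `B_k ∩ 2^{σ k} = 2^η`. -/
def IsStackedBall (d m : ℕ) (σ : Fin m → Finset ℕ) : Prop :=
  (∀ i : Fin m, (σ i).card = d + 2) ∧
  ∀ k : Fin m, 0 < k.val →
    ∃ η : Finset ℕ, η.card = d + 1 ∧ η ⊆ σ k ∧
      (∃! i : Fin m, i.val < k.val ∧ η ⊆ σ i) ∧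
      (∀ τ : Finset ℕ, τ ⊆ σ k → (memBall σ k.val τ ↔ τ ⊆ η))

/-- The facets of the stacked `d`-sphere `S = ∂(σ₁,…,σ_m)`: the `(d+1)`-element free
faces of the stacked `(d+1)`-ball, i.e. the `(d+1)`-element sets contained in a unique
simplex `σ i`. -/
def sphereFacets (d m : ℕ) (σ : Fin m → Finset ℕ) : Set (Finset ℕ) :=
  {f | f.card = d + 1 ∧ ∃! i : Fin m, f ⊆ σ i}

/-- The vertex set of the stacked ball `∂(σ₁,…,σ_m)` and of its boundary sphere. -/
def vertexSet (m : ℕ) (σ : Fin m → Finset ℕ) : Finset ℕ :=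
  Finset.univ.biUnion σ

/-- `T` is a transversal of the hypergraph `H`: it meets every edge of `H`. -/
def IsTransversal (T : Finset ℕ) (H : Set (Finset ℕ)) : Prop :=
  ∀ e ∈ H, (T ∩ e).Nonempty

/-- The transversal number `τ(H)` of a hypergraph `H`: the minimum size of a transversal. -/
noncomputable def tau (H : Set (Finset ℕ)) : ℕ :=
  sInf {n | ∃ T : Finset ℕ, T.card = n ∧ IsTransversal T H}

/-- Adjacency in the dual graph `G(B)`: `i ≠ j` and `σ i ∩ σ j` is a `d`-simplex. -/
def DualAdj (d m : ℕ) (σ : Fin m → Finset ℕ) (i j : Fin m) : Prop :=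
  i ≠ j ∧ (σ i ∩ σ j).card = d + 1

/-- The dual graph `G(B)` is the path `1 – 2 – ⋯ – m` in this index order. -/
def IsPathOrder (d m : ℕ) (σ : Fin m → Finset ℕ) : Prop :=
  ∀ i j : Fin m, DualAdj d m σ i j ↔ (i.val + 1 = j.val ∨ j.val + 1 = i.val)

/-- The stacked sphere is linear: its dual graph `G(B)` is a path. -/
def IsLinear (d m : ℕ) (σ : Fin m → Finset ℕ) : Prop :=
  ∃ e : Fin m ≃ Fin m, ∀ i j : Fin m,
    DualAdj d m σ i j ↔ ((e i).val + 1 = (e j).val ∨ (e j).val + 1 = (e i).val)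


namespace LSS

/-- increments to the next occurrence of the same slot -/
def inc (d p : ℕ) : ℕ :=
  if p = 0 then d + 3
  else if p = 1 then d + 1
  else if p = 2 then 2 * d + 1
  else if p ≤ d + 1 then d + 1
  else if p = d + 2 then d + 2
  else if p ≤ 2 * d + 2 then d + 4
  else if p = 2 * d + 3 then 2
  else if p = 2 * d + 4 then 2
  else if p = 2 * d + 5 then d + 2
  else if p = 2 * d + 6 then d + 3
  else if p = 2 * d + 7 then d + 1
  else if p ≤ 3 * d + 6 then d + 3
  else 3

/-- death time of vertex `t` -/
def nx (d t : ℕ) : ℕ := t + inc d (t % (3 * d + 8))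

/-- vertices alive when `N` vertices have been born -/
def S (d N : ℕ) : Finset ℕ := (range N).filter (fun t => N ≤ nx d t)

lemma mem_S {d N t : ℕ} : t ∈ S d N ↔ t < N ∧ N ≤ nx d t := by
  simp [S]

lemma nx_eq (d q p : ℕ) (hp : p < 3 * d + 8) :
    nx d ((3 * d + 8) * q + p) = (3 * d + 8) * q + (p + inc d p) := by
  unfold nx
  rw [Nat.mul_add_mod, Nat.mod_eq_of_lt hp]; ring

lemma decomp (d t : ℕ) : ∃ q p, p < 3 * d + 8 ∧ t = (3 * d + 8) * q + p :=
  ⟨t / (3 * d + 8), t % (3 * d + 8), Nat.mod_lt _ (by omega), (Nat.div_add_mod _ _).symm⟩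

lemma inc_spec (d p v : ℕ) (hd : 2 ≤ d) (hv : v = inc d p) :
    (p = 0 ∧ v = d + 3) ∨
    (p = 1 ∧ v = d + 1) ∨
    (p = 2 ∧ v = 2 * d + 1) ∨
    (3 ≤ p ∧ p ≤ d + 1 ∧ v = d + 1) ∨
    (p = d + 2 ∧ v = d + 2) ∨
    (d + 3 ≤ p ∧ p ≤ 2 * d + 2 ∧ v = d + 4) ∨
    (p = 2 * d + 3 ∧ v = 2) ∨
    (p = 2 * d + 4 ∧ v = 2) ∨
    (p = 2 * d + 5 ∧ v = d + 2) ∨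
    (p = 2 * d + 6 ∧ v = d + 3) ∨
    (p = 2 * d + 7 ∧ v = d + 1) ∨
    (2 * d + 8 ≤ p ∧ p ≤ 3 * d + 6 ∧ v = d + 3) ∨
    (3 * d + 7 ≤ p ∧ v = 3) := by
  unfold inc at hv
  by_cases h0 : p = 0
  · rw [if_pos h0] at hv
    left; exact ⟨h0, hv⟩
  rw [if_neg h0] at hv
  by_cases h1 : p = 1
  · rw [if_pos h1] at hv
    iterate 1 right
    left; exact ⟨h1, hv⟩
  rw [if_neg h1] at hv
  by_cases h2 : p = 2
  · rw [if_pos h2] at hv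
    iterate 2 right
    left; exact ⟨h2, hv⟩
  rw [if_neg h2] at hv
  by_cases h3 : p ≤ d + 1
  · rw [if_pos h3] at hv
    iterate 3 right
    left; exact ⟨by omega, h3, hv⟩
  rw [if_neg h3] at hv
  by_cases h4 : p = d + 2
  · rw [if_pos h4] at hv
    iterate 4 right
    left; exact ⟨h4, hv⟩
  rw [if_neg h4] at hv
  by_cases h5 : p ≤ 2 * d + 2
  · rw [if_pos h5] at hv
    iterate 5 right
    left; exact ⟨by omega, h5, hv⟩
  rw [if_neg h5] at hv
  by_cases h6 : p = 2 * d + 3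
  · rw [if_pos h6] at hv
    iterate 6 right
    left; exact ⟨h6, hv⟩
  rw [if_neg h6] at hv
  by_cases h7 : p = 2 * d + 4
  · rw [if_pos h7] at hv
    iterate 7 right
    left; exact ⟨h7, hv⟩
  rw [if_neg h7] at hv
  by_cases h8 : p = 2 * d + 5
  · rw [if_pos h8] at hv
    iterate 8 right
    left; exact ⟨h8, hv⟩
  rw [if_neg h8] at hv
  by_cases h9 : p = 2 * d + 6
  · rw [if_pos h9] at hv
    iterate 9 right
    left; exact ⟨h9, hv⟩
  rw [if_neg h9] at hv
  by_cases h10 : p = 2 * d + 7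
  · rw [if_pos h10] at hv
    iterate 10 right
    left; exact ⟨h10, hv⟩
  rw [if_neg h10] at hv
  by_cases h11 : p ≤ 3 * d + 6
  · rw [if_pos h11] at hv
    iterate 11 right
    left; exact ⟨by omega, h11, hv⟩
  rw [if_neg h11] at hv
  iterate 12 right
  exact ⟨by omega, hv⟩

lemma inc_ge (d p : ℕ) (hd : 2 ≤ d) : 2 ≤ inc d p := by
  have := inc_spec d p _ hd rfl
  omega

lemma inc_lo (d p : ℕ) (hd : 2 ≤ d) : d + 2 ≤ p + inc d p := by
  have := inc_spec d p _ hd rfl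
  omega

lemma inc_hi (d p : ℕ) (hd : 2 ≤ d) (hp : p < 3 * d + 8) : p + inc d p ≤ 3 * d + 8 + d + 1 := by
  have := inc_spec d p _ hd rfl
  omega

lemma inc_inj (d p p' : ℕ) (hd : 2 ≤ d) (hp : p < 3 * d + 8) (hp' : p' < 3 * d + 8)
    (h : p + inc d p = p' + inc d p') : p = p' := by
  have h1 := inc_spec d p _ hd rfl
  have h2 := inc_spec d p' _ hd rfl
  rcases h1 with h1 | h1 | h1 | h1 | h1 | h1 | h1 | h1 | h1 | h1 | h1 | h1 | h1 <;> omega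

lemma nx_ge (d t : ℕ) (hd : 2 ≤ d) : t + 2 ≤ nx d t := by
  have := inc_ge d (t % (3 * d + 8)) hd
  unfold nx; omega

lemma nx_lo (d t : ℕ) (hd : 2 ≤ d) : d + 2 ≤ nx d t := by
  obtain ⟨q, p, hp, rfl⟩ := decomp d t
  rw [nx_eq d q p hp]
  have := inc_lo d p hd
  omega

lemma nx_inj (d t t' : ℕ) (hd : 2 ≤ d) (h : nx d t = nx d t') : t = t' := by
  obtain ⟨q, p, hp, rfl⟩ := decomp d t
  obtain ⟨q', p', hp', rfl⟩ := decomp d t'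
  rw [nx_eq d q p hp, nx_eq d q' p' hp'] at h
  have h1 := inc_lo d p hd
  have h2 := inc_lo d p' hd
  have h3 := inc_hi d p hd hp
  have h4 := inc_hi d p' hd hp'
  rcases lt_trichotomy q q' with hq | hq | hq
  · have := Nat.mul_le_mul_left (3 * d + 8) (show q + 1 ≤ q' from hq)
    rw [Nat.mul_add] at this
    omega
  · subst hq
    have := inc_inj d p p' hd hp hp' (by omega)
    omega
  · have := Nat.mul_le_mul_left (3 * d + 8) (show q' + 1 ≤ q from hq)
    rw [Nat.mul_add] at this
    omega

lemma inc_surj (d v : ℕ) (hd : 2 ≤ d) (h1 : d + 2 ≤ v) (h2 : v ≤ 3 * d + 8 + d + 1) :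
    ∃ p, p < 3 * d + 8 ∧ p + inc d p = v := by
  have key : ∀ p, p < 3 * d + 8 → p + inc d p = v → ∃ p, p < 3 * d + 8 ∧ p + inc d p = v :=
    fun p a b => ⟨p, a, b⟩
  by_cases c1 : v = d + 2
  · have := inc_spec d 1 _ hd rfl
    exact key 1 (by omega) (by omega)
  by_cases c2 : v = d + 3
  · have := inc_spec d 0 _ hd rfl
    exact key 0 (by omega) (by omega)
  by_cases c3 : v ≤ 2 * d + 2
  · have := inc_spec d (v - (d + 1)) _ hd rfl
    exact key (v - (d + 1)) (by omega) (by omega)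
  by_cases c4 : v = 2 * d + 3
  · have := inc_spec d 2 _ hd rfl
    exact key 2 (by omega) (by omega)
  by_cases c5 : v = 2 * d + 4
  · have := inc_spec d (d + 2) _ hd rfl
    exact key (d + 2) (by omega) (by omega)
  by_cases c6 : v = 2 * d + 5
  · have := inc_spec d (2 * d + 3) _ hd rfl
    exact key (2 * d + 3) (by omega) (by omega)
  by_cases c7 : v = 2 * d + 6
  · have := inc_spec d (2 * d + 4) _ hd rfl
    exact key (2 * d + 4) (by omega) (by omega)
  by_cases c8 : v ≤ 3 * d + 6
  · have := inc_spec d (v - (d + 4)) _ hd rfl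
    exact key (v - (d + 4)) (by omega) (by omega)
  by_cases c9 : v = 3 * d + 7
  · have := inc_spec d (2 * d + 5) _ hd rfl
    exact key (2 * d + 5) (by omega) (by omega)
  by_cases c10 : v = 3 * d + 8
  · have := inc_spec d (2 * d + 7) _ hd rfl
    exact key (2 * d + 7) (by omega) (by omega)
  by_cases c11 : v = 3 * d + 9
  · have := inc_spec d (2 * d + 6) _ hd rfl
    exact key (2 * d + 6) (by omega) (by omega)
  by_cases c12 : v = 3 * d + 10
  · have := inc_spec d (3 * d + 7) _ hd rfl
    exact key (3 * d + 7) (by omega) (by omega)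
  · have := inc_spec d (v - (d + 3)) _ hd rfl
    exact key (v - (d + 3)) (by omega) (by omega)

lemma nx_surj (d N : ℕ) (hd : 2 ≤ d) (hN : d + 2 ≤ N) : ∃ t, nx d t = N := by
  obtain ⟨q, p, hp, rfl⟩ := decomp d N
  by_cases h : d + 2 ≤ p
  · obtain ⟨r, hr, e⟩ := inc_surj d p hd h (by omega)
    exact ⟨(3 * d + 8) * q + r, by rw [nx_eq d q r hr, e]⟩
  · obtain ⟨r, hr, e⟩ := inc_surj d (p + (3 * d + 8)) hd (by omega) (by omega)
    rcases q with _ | q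
    · omega
    · refine ⟨(3 * d + 8) * q + r, ?_⟩
      rw [nx_eq d q r hr, e]; ring

lemma S_succ (d N x : ℕ) (hd : 2 ≤ d) (hx : nx d x = N) :
    S d (N + 1) = insert N ((S d N).erase x) := by
  ext t
  simp only [mem_S, mem_insert, mem_erase]
  have h1 := nx_ge d t hd
  constructor
  · rintro ⟨a, b⟩
    by_cases h : t = N
    · exact Or.inl h
    · refine Or.inr ⟨?_, by omega, by omega⟩
      rintro rfl; omega
  · rintro (rfl | ⟨a, b, c⟩)
    · omega
    · have : nx d t ≠ N := fun h => a (nx_inj d t x hd (h.trans hx.symm))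
      omega

lemma card_S (d N : ℕ) (hd : 2 ≤ d) (hN : d + 2 ≤ N) : (S d N).card = d + 2 := by
  induction N, hN using Nat.le_induction with
  | base =>
    have : S d (d + 2) = range (d + 2) := by
      ext t
      have := nx_lo d t hd
      simp only [mem_S, mem_range]; omega
    rw [this, card_range]
  | succ N hN ih =>
    obtain ⟨x, hx⟩ := nx_surj d N hd hN
    have hxm : x ∈ S d N := by
      have := nx_ge d x hd
      rw [mem_S]; omega
    rw [S_succ d N x hd hx, card_insert_of_notMem, card_erase_of_mem hxm, ih]
    · omega
    · simp [mem_S]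

/-- the free-face criterion -/
lemma facet (d n m : ℕ) (hd : 2 ≤ d) (hm : m + (d + 1) = n) (T : Finset ℕ)
    (hT : IsTransversal T (sphereFacets d m (fun i : Fin m => S d (i.val + (d + 2)))))
    (N : ℕ) (h1 : d + 2 ≤ N) (h2 : N ≤ n) (y : ℕ) (hy1 : y + 1 ≠ N) (hy2 : nx d y ≠ N) :
    ∃ z ∈ T, z < N ∧ N ≤ nx d z ∧ z ≠ y := by
  obtain ⟨x, hx⟩ := nx_surj d N hd h1
  have hxN := nx_ge d x hd
  have main : ∀ y ∈ S d N, y + 1 ≠ N → nx d y ≠ N → ∃ z ∈ T, z < N ∧ N ≤ nx d z ∧ z ≠ y := by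
    intro y hy hy1 hy2
    have hf : (S d N).erase y ∈
        sphereFacets d m (fun i : Fin m => S d (i.val + (d + 2))) := by
      refine ⟨by rw [card_erase_of_mem hy, card_S d N hd h1]; omega, ⟨N - (d + 2), by omega⟩, ?_, ?_⟩
      · have : N - (d + 2) + (d + 2) = N := by omega
        simp only [this]
        exact erase_subset _ _
      · rintro ⟨j, hj⟩ hsub
        simp only at hsub
        have a1 : N - 1 ∈ (S d N).erase y := by
          have := nx_ge d (N - 1) hd
          rw [mem_erase, mem_S]; omega
        have a2 : x ∈ (S d N).erase y := by
          rw [mem_erase, mem_S]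
          refine ⟨?_, by omega, by omega⟩
          rintro rfl; omega
        have b1 := mem_S.1 (hsub a1)
        have b2 := mem_S.1 (hsub a2)
        ext
        simp only
        omega
    obtain ⟨z, hz⟩ := hT _ hf
    rw [mem_inter, mem_erase, mem_S] at hz
    exact ⟨z, hz.1, hz.2.2.1, hz.2.2.2, hz.2.1⟩
  by_cases hy : y ∈ S d N
  · exact main y hy hy1 hy2
  · have : (((S d N).erase x).erase (N - 1)).Nonempty := by
      rw [← card_pos]
      have e1 := pred_card_le_card_erase (s := S d N) (a := x)
      have e2 := pred_card_le_card_erase (s := (S d N).erase x) (a := N - 1)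
      rw [card_S d N hd h1] at e1
      omega
    obtain ⟨w, hw⟩ := this
    rw [mem_erase, mem_erase] at hw
    obtain ⟨z, hz, c1, c2, c3⟩ := main w hw.2.2 (by omega)
      (fun h => hw.2.1 (nx_inj d w x hd (h.trans hx.symm)))
    refine ⟨z, hz, c1, c2, ?_⟩
    rintro rfl
    exact hy (mem_S.2 ⟨c1, c2⟩)

lemma two_le {U : Finset ℕ} {a b : ℕ} (ha : a ∈ U) (hb : b ∈ U) (h : a ≠ b) : 2 ≤ U.card :=
  Finset.one_lt_card.2 ⟨a, ha, b, hb, h⟩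

lemma block (d : ℕ) (hd : 2 ≤ d) (U : Finset ℕ)
    (H : ∀ N, d + 2 ≤ N → N ≤ 3 * d + 8 → ∀ y, y < 3 * d + 8 → y + 1 ≠ N → y + inc d y ≠ N →
      ∃ z ∈ U, z < N ∧ N ≤ z + inc d z ∧ z ≠ y) :
    6 ≤ U.card := by
  have S1 : ∀ y, y < d + 1 → y ≠ 1 → ∃ z ∈ U, z < d + 2 ∧ z ≠ y := by
    intro y hy hy1
    obtain ⟨z, hz, a, b, c⟩ := H (d + 2) (by omega) (by omega) y (by omega) (by omega)
      (by have := inc_spec d y _ hd rfl; omega)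
    exact ⟨z, hz, a, c⟩
  have S2 : ∀ y, y < d + 2 → y ≠ 0 → ∃ z ∈ U, z < d + 3 ∧ z ≠ 1 ∧ z ≠ y := by
    intro y hy hy1
    obtain ⟨z, hz, a, b, c⟩ := H (d + 3) (by omega) (by omega) y (by omega) (by omega)
      (by have := inc_spec d y _ hd rfl; omega)
    refine ⟨z, hz, a, ?_, c⟩
    rintro rfl
    have := inc_spec d 1 _ hd rfl; omega
  have S2r : ∃ z ∈ U, z = 2 ∨ (d + 3 ≤ z ∧ z ≤ 2 * d + 2) := by
    obtain ⟨z, hz, a, b, c⟩ := H (2 * d + 3) (by omega) (by omega) (d + 2) (by omega) (by omega)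
      (by have := inc_spec d (d + 2) _ hd rfl; omega)
    refine ⟨z, hz, ?_⟩
    have := inc_spec d z _ hd rfl; omega
  have S3 : ∃ z ∈ U, z = d + 2 ∨ z = 2 * d + 3 ∨ (d + 3 ≤ z ∧ z ≤ 2 * d + 2) := by
    obtain ⟨z, hz, a, b, c⟩ := H (2 * d + 4) (by omega) (by omega) (d + 3) (by omega) (by omega)
      (by have := inc_spec d (d + 3) _ hd rfl; omega)
    refine ⟨z, hz, ?_⟩
    have := inc_spec d z _ hd rfl; omega
  have S4 : ∀ y, d + 3 ≤ y → y ≤ 2 * d + 2 → ∃ z ∈ U, z ≠ y ∧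
      (z = 2 * d + 3 ∨ z = 2 * d + 4 ∨ (d + 3 ≤ z ∧ z ≤ 2 * d + 2)) := by
    intro y hy hy1
    obtain ⟨z, hz, a, b, c⟩ := H (2 * d + 5) (by omega) (by omega) y (by omega) (by omega)
      (by have := inc_spec d y _ hd rfl; omega)
    refine ⟨z, hz, c, ?_⟩
    have := inc_spec d z _ hd rfl; omega
  have S5 : ∃ z ∈ U, z = 2 * d + 4 ∨ z = 2 * d + 5 ∨ (d + 3 ≤ z ∧ z ≤ 2 * d + 2) := by
    obtain ⟨z, hz, a, b, c⟩ := H (2 * d + 6) (by omega) (by omega) (d + 3) (by omega) (by omega)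
      (by have := inc_spec d (d + 3) _ hd rfl; omega)
    refine ⟨z, hz, ?_⟩
    have := inc_spec d z _ hd rfl; omega
  have S6 : ∃ z ∈ U, z = 2 * d + 6 ∨ (d + 3 ≤ z ∧ z ≤ 2 * d + 2) := by
    obtain ⟨z, hz, a, b, c⟩ := H (2 * d + 7) (by omega) (by omega) (2 * d + 5) (by omega)
      (by omega) (by have := inc_spec d (2 * d + 5) _ hd rfl; omega)
    refine ⟨z, hz, ?_⟩
    have := inc_spec d z _ hd rfl; omega
  have S6r : ∀ y, 2 * d + 6 ≤ y → y < 3 * d + 6 → ∃ z ∈ U, z ≠ y ∧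
      2 * d + 5 ≤ z ∧ z < 3 * d + 7 := by
    intro y hy hy1
    obtain ⟨z, hz, a, b, c⟩ := H (3 * d + 7) (by omega) (by omega) y (by omega) (by omega)
      (by have := inc_spec d y _ hd rfl; omega)
    refine ⟨z, hz, c, ?_⟩
    have := inc_spec d z _ hd rfl; omega
  have S7 : ∀ y, 2 * d + 6 ≤ y → y < 3 * d + 7 → y ≠ 2 * d + 7 → ∃ z ∈ U, z ≠ y ∧
      2 * d + 6 ≤ z ∧ z < 3 * d + 8 := by
    intro y hy hy1 hy2
    obtain ⟨z, hz, a, b, c⟩ := H (3 * d + 8) (by omega) (by omega) y (by omega) (by omega)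
      (by have := inc_spec d y _ hd rfl; omega)
    refine ⟨z, hz, c, ?_⟩
    have := inc_spec d z _ hd rfl; omega
  -- four disjoint parts
  have parts4 : ∀ a b c : ℕ, a ≤ b → b ≤ c →
      (U.filter (· < a)).card + (U.filter (fun z => a ≤ z ∧ z < b)).card
        + (U.filter (fun z => b ≤ z ∧ z < c)).card + (U.filter (fun z => c ≤ z)).card
        = U.card := by
    intro a b c hab hbc
    simp only [card_filter]
    rw [card_eq_sum_ones, ← sum_add_distrib, ← sum_add_distrib, ← sum_add_distrib]
    apply sum_congr rfl
    intro z _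
    split_ifs <;> omega
  by_cases hB : ∃ b ∈ U, d + 3 ≤ b ∧ b ≤ 2 * d + 2
  · obtain ⟨b, hb, hb1, hb2⟩ := hB
    have hL : 2 ≤ (U.filter (· < d + 3)).card := by
      obtain ⟨z, hz, c1, c2⟩ := S1 2 (by omega) (by omega)
      have : ∃ w ∈ U, w < d + 3 ∧ w ≠ z := by
        by_cases e1 : z = 1
        · obtain ⟨w, hw, e, f, g⟩ := S2 2 (by omega) (by omega)
          exact ⟨w, hw, e, by omega⟩
        by_cases e2 : z = d + 1
        · obtain ⟨w, hw, e, f, g⟩ := S2 (d + 1) (by omega) (by omega)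
          exact ⟨w, hw, e, by omega⟩
        · obtain ⟨w, hw, e, f⟩ := S1 z (by omega) e1
          exact ⟨w, hw, by omega, f⟩
      obtain ⟨w, hw, f1, f2⟩ := this
      exact two_le (mem_filter.2 ⟨hw, f1⟩) (mem_filter.2 ⟨hz, by omega⟩) f2
    have hR : 2 ≤ (U.filter (fun z => 2 * d + 5 ≤ z)).card := by
      obtain ⟨z, hz, c1, c2, c3⟩ := S7 (2 * d + 6) (by omega) (by omega) (by omega)
      have : ∃ w ∈ U, 2 * d + 5 ≤ w ∧ w ≠ z := by
        by_cases e1 : z = 3 * d + 7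
        · obtain ⟨w, hw, e, f, g⟩ := S6r (2 * d + 6) (by omega) (by omega)
          exact ⟨w, hw, f, by omega⟩
        by_cases e2 : z = 2 * d + 7
        · obtain ⟨w, hw, e, f, g⟩ := S6r (2 * d + 7) (by omega) (by omega)
          exact ⟨w, hw, f, by omega⟩
        · obtain ⟨w, hw, e, f, g⟩ := S7 z (by omega) (by omega) e2
          exact ⟨w, hw, by omega, e⟩
      obtain ⟨w, hw, f1, f2⟩ := this
      exact two_le (mem_filter.2 ⟨hw, f1⟩) (mem_filter.2 ⟨hz, by omega⟩) f2
    have hM : 2 ≤ (U.filter (fun z => d + 3 ≤ z ∧ z < 2 * d + 5)).card := by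
      obtain ⟨z, hz, c1, c2⟩ := S4 b hb1 hb2
      exact two_le (mem_filter.2 ⟨hz, by omega⟩) (mem_filter.2 ⟨hb, by omega⟩) c1
    have := parts4 (d + 3) (2 * d + 5) (2 * d + 5) (by omega) (by omega)
    omega
  · have hB' : ∀ b ∈ U, ¬ (d + 3 ≤ b ∧ b ≤ 2 * d + 2) := fun b hb h => hB ⟨b, hb, h⟩
    have hL : 2 ≤ (U.filter (· < d + 2)).card := by
      obtain ⟨z, hz, c⟩ := S2r
      have := hB' z hz
      obtain ⟨w, hw, e, f⟩ := S1 2 (by omega) (by omega)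
      exact two_le (mem_filter.2 ⟨hw, by omega⟩) (mem_filter.2 ⟨hz, by omega⟩) (by omega)
    have hR : 2 ≤ (U.filter (fun z => 2 * d + 6 ≤ z)).card := by
      obtain ⟨z, hz, c⟩ := S6
      have := hB' z hz
      obtain ⟨w, hw, e, f, g⟩ := S7 (2 * d + 6) (by omega) (by omega) (by omega)
      exact two_le (mem_filter.2 ⟨hw, by omega⟩) (mem_filter.2 ⟨hz, by omega⟩) (by omega)
    have hM : 2 ≤ (U.filter (fun z => d + 2 ≤ z ∧ z < 2 * d + 6)).card := by
      obtain ⟨z, hz, c⟩ := S3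
      have h1 := hB' z hz
      obtain ⟨w, hw, e⟩ := S5
      have h2 := hB' w hw
      exact two_le (mem_filter.2 ⟨hw, by omega⟩) (mem_filter.2 ⟨hz, by omega⟩) (by omega)
    have := parts4 (d + 2) (2 * d + 6) (2 * d + 6) (by omega) (by omega)
    omega

lemma card_blocks (P k : ℕ) (T : Finset ℕ)
    (h : ∀ q, q < k → 6 ≤ (T.filter (fun z => P * q ≤ z ∧ z < P * q + P)).card) :
    6 * k ≤ (T.filter (· < P * k)).card := by
  induction k with
  | zero => simp
  | succ k ih =>
    have h1 := ih (fun q hq => h q (by omega))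
    have h2 := h k (by omega)
    have h3 : (T.filter (· < P * k)).card + (T.filter (fun z => P * k ≤ z ∧ z < P * k + P)).card
        = (T.filter (· < P * (k + 1))).card := by
      rw [Nat.mul_succ]
      simp only [card_filter]
      rw [← sum_add_distrib]
      apply sum_congr rfl
      intro z _
      split_ifs <;> omega
    omega

lemma lower (d k m : ℕ) (hd : 2 ≤ d) (hm : m + (d + 1) = (3 * d + 8) * k) (T : Finset ℕ)
    (hT : IsTransversal T (sphereFacets d m (fun i : Fin m => S d (i.val + (d + 2))))) :
    6 * k ≤ T.card := by
  refine (card_blocks (3 * d + 8) k T ?_).trans (card_filter_le _ _)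
  intro q hq
  have hqk := Nat.mul_le_mul_left (3 * d + 8) (show q + 1 ≤ k from hq)
  rw [Nat.mul_add, Nat.mul_one] at hqk
  set V := T.filter (fun z => (3 * d + 8) * q ≤ z ∧ z < (3 * d + 8) * q + (3 * d + 8)) with hV
  have hb := block d hd (V.image (fun z => z - (3 * d + 8) * q)) ?_
  · exact hb.trans card_image_le
  intro N h1 h2 y hy hy1 hy2
  obtain ⟨z, hz, a, b, c⟩ := facet d _ m hd hm T hT ((3 * d + 8) * q + N) (by omega) (by omega)
    ((3 * d + 8) * q + y) (by omega) (by rw [nx_eq d q y hy]; omega)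
  obtain ⟨q', p, hp, rfl⟩ := decomp d z
  rw [nx_eq d q' p hp] at b
  have hi := inc_hi d p hd hp
  have hqq : q' = q := by
    rcases lt_trichotomy q' q with h | h | h
    · have := Nat.mul_le_mul_left (3 * d + 8) (show q' + 1 ≤ q from h)
      rw [Nat.mul_add] at this
      omega
    · exact h
    · have := Nat.mul_le_mul_left (3 * d + 8) (show q + 1 ≤ q' from h)
      rw [Nat.mul_add] at this
      omega
  subst hqq
  refine ⟨p, mem_image.2 ⟨_, mem_filter.2 ⟨hz, by omega, by omega⟩, by omega⟩, by omega, by omega,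
    by omega⟩

lemma inter_card (d M N : ℕ) (hd : 2 ≤ d) (hM : d + 2 ≤ M) (h : M < N) :
    (S d M ∩ S d N).card = d + 1 ↔ M + 1 = N := by
  constructor
  · intro hc
    by_contra hne
    have hsub : S d M ∩ S d N ⊆ ((S d N).erase (N - 1)).erase (N - 2) := by
      intro t ht
      rw [mem_inter, mem_S, mem_S] at ht
      rw [mem_erase, mem_erase, mem_S]
      omega
    have h1 : N - 1 ∈ S d N := by
      have := nx_ge d (N - 1) hd
      rw [mem_S]; omega
    have h2 : N - 2 ∈ (S d N).erase (N - 1) := by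
      have := nx_ge d (N - 2) hd
      rw [mem_erase, mem_S]; omega
    have := card_le_card hsub
    rw [card_erase_of_mem h2, card_erase_of_mem h1, card_S d N hd (by omega)] at this
    omega
  · rintro rfl
    have : S d M ∩ S d (M + 1) = (S d (M + 1)).erase M := by
      ext t
      rw [mem_inter, mem_erase, mem_S, mem_S]
      omega
    rw [this, card_erase_of_mem, card_S d _ hd (by omega)]
    · omega
    · have := nx_ge d M hd
      rw [mem_S]; omega

end LSS

/-- **Theorem (Lower bound, linear case).** For all integers `d ≥ 2` and `k ≥ 1`,
there exists a linear stacked `d`-sphere `S` on `(3d+8)k` vertices with `τ(S) ≥ 6k`. -/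
theorem linear_stacked_sphere_lower_bound (d k : ℕ) (hd : 2 ≤ d) (hk : 1 ≤ k) :
    ∃ (m : ℕ) (σ : Fin m → Finset ℕ),
      IsStackedBall d m σ ∧ IsLinear d m σ ∧
      (vertexSet m σ).card = (3 * d + 8) * k ∧
      6 * k ≤ tau (sphereFacets d m σ) := by
  have hP : 3 * d + 8 ≤ (3 * d + 8) * k := Nat.le_mul_of_pos_right _ hk
  obtain ⟨m, hm⟩ : ∃ m, m + (d + 1) = (3 * d + 8) * k := ⟨(3 * d + 8) * k - (d + 1), by omega⟩
  refine ⟨m, fun i : Fin m => LSS.S d (i.val + (d + 2)), ⟨?_, ?_⟩, ⟨Equiv.refl _, ?_⟩, ?_, ?_⟩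
  · intro i
    exact LSS.card_S d _ hd (by omega)
  · rintro ⟨j, hj⟩ hj0
    simp only at hj0
    have hnew : j + (d + 1) ∈ LSS.S d (j + (d + 2)) := by
      have := LSS.nx_ge d (j + (d + 1)) hd
      rw [LSS.mem_S]; omega
    have hsub : (LSS.S d (j + (d + 2))).erase (j + (d + 1)) ⊆ LSS.S d (j - 1 + (d + 2)) := by
      intro t ht
      rw [mem_erase, LSS.mem_S] at ht
      rw [LSS.mem_S]; omega
    refine ⟨(LSS.S d (j + (d + 2))).erase (j + (d + 1)), ?_, erase_subset _ _,
      ⟨⟨j - 1, by omega⟩, ⟨?_, hsub⟩, ?_⟩, ?_⟩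
    · rw [card_erase_of_mem hnew, LSS.card_S d _ hd (by omega)]; omega
    · simp only; omega
    · rintro ⟨i, hi⟩ ⟨h1, h2⟩
      simp only at h1 h2
      have h3 : j + d ∈ (LSS.S d (j + (d + 2))).erase (j + (d + 1)) := by
        have := LSS.nx_ge d (j + d) hd
        rw [mem_erase, LSS.mem_S]; omega
      have h4 := LSS.mem_S.1 (h2 h3)
      ext
      simp only
      omega
    · intro τ hτ
      constructor
      · rintro ⟨⟨i, hi⟩, h1, h2⟩ t ht
        simp only at h1 h2
        have h3 := LSS.mem_S.1 (h2 ht)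
        exact mem_erase.2 ⟨by omega, hτ ht⟩
      · intro h
        exact ⟨⟨j - 1, by omega⟩, by simp only; omega, h.trans hsub⟩
  · rintro ⟨i, hi⟩ ⟨j, hj⟩
    simp only [DualAdj, Equiv.refl_apply, ne_eq, Fin.mk.injEq]
    rcases lt_trichotomy i j with h | h | h
    · rw [LSS.inter_card d _ _ hd (by omega) (by omega)]; omega
    · omega
    · rw [inter_comm, LSS.inter_card d _ _ hd (by omega) (by omega)]; omega
  · have : vertexSet m (fun i : Fin m => LSS.S d (i.val + (d + 2))) = range ((3 * d + 8) * k) := by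
      ext t
      simp only [vertexSet, mem_biUnion, mem_univ, true_and, mem_range]
      constructor
      · rintro ⟨⟨i, hi⟩, h⟩
        have := LSS.mem_S.1 h
        simp only at this
        omega
      · intro ht
        have h1 := LSS.nx_ge d t hd
        have h2 := LSS.nx_lo d t hd
        refine ⟨⟨t + 1 - (d + 2), by omega⟩, ?_⟩
        rw [LSS.mem_S]
        simp only
        omega
    rw [this, card_range]
  · have hne : {n | ∃ T : Finset ℕ, T.card = n ∧ IsTransversal T
        (sphereFacets d m (fun i : Fin m => LSS.S d (i.val + (d + 2))))}.Nonempty := by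
      refine ⟨_, vertexSet m (fun i : Fin m => LSS.S d (i.val + (d + 2))), rfl, ?_⟩
      rintro f ⟨hf, i, hi, -⟩
      obtain ⟨z, hz⟩ : f.Nonempty := by rw [← card_pos]; omega
      exact ⟨z, mem_inter.2 ⟨mem_biUnion.2 ⟨i, mem_univ _, hi hz⟩, hz⟩⟩
    obtain ⟨T, hT1, hT2⟩ := Nat.sInf_mem hne
    rw [tau, ← hT1]
    exact LSS.lower d k m hd hm T hT2
end

section
/- Let n ≥ 4 be an integer and let S be a linear stacked 2-sphere on n vertices. Then S has a transversal of size at most ⌈3n/7⌉, i.e. τ(S) ≤ ⌈3n/7⌉. -/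
open Finset

def lsCls : List (List (ℕ × ℕ)) :=
  [[(3, 14), (5, 14), (6, 14), (8, 7)],
   [(3, 10), (4, 10), (9, 10)],
   [(3, 9), (4, 9), (8, 9)],
   [(3, 11), (5, 11), (9, 11)],
   [(3, 13), (5, 13), (6, 13), (9, 13), (10, 13)],
   [(3, 7)],
   [(9, 7)],
   [(3, 12), (8, 5)],
   [(3, 11), (4, 11), (9, 11), (10, 11)],
   [(4, 10), (9, 10), (10, 10)],
   [(3, 10), (9, 10), (10, 10)],
   [(8, 4)],
   [(2, 9), (9, 9)],
   [(3, 13), (5, 13), (8, 6)],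
   [(1, 8), (6, 15), (8, 8)],
   [(3, 12), (5, 12), (9, 12), (10, 12)]]

def lsTab : List (List (ℕ × ℕ)) :=
  [[(8, 0), (8, 4), (8, 8)],
   [(0, 0), (0, 4), (0, 8)],
   [(0, 0), (0, 4), (0, 8)],
   [(12, 0), (12, 4), (12, 8)],
   [(10, 0), (10, 4), (10, 8)],
   [(3, 0), (3, 4), (3, 8)],
   [(11, 0), (3, 4), (3, 8)],
   [(12, 2), (12, 5), (2, 8)],
   [(14, 0), (14, 4), (14, 8)],
   [(0, 0), (0, 4), (0, 8)],
   [(6, 0), (6, 4), (5, 8)],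
   [(14, 3), (14, 6), (14, 10)],
   [(13, 0), (13, 4), (4, 8)],
   [(9, 0), (1, 4), (1, 8)],
   [(7, 0), (15, 4), (15, 8)],
   [(12, 0), (12, 4), (12, 8)]]

def lsPerms : List (Fin 4 → Fin 4) :=
  [![1, 2, 3, 0], ![2, 1, 3, 0], ![1, 3, 2, 0], ![3, 1, 2, 0],
   ![0, 2, 3, 1], ![0, 3, 2, 1], ![3, 0, 2, 1], ![2, 0, 3, 1],
   ![0, 1, 3, 2], ![0, 3, 1, 2], ![3, 0, 1, 2], ![1, 0, 3, 2]]

def lsBits (A : ℕ) : ℕ :=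
  (A.testBit 0).toNat + (A.testBit 1).toNat + (A.testBit 2).toNat + (A.testBit 3).toNat

/-- Old mask `M` (only the three surviving positions count) together with the added set `A`. -/
def lsU (M A : ℕ) (i : Fin 4) : Bool := (decide (i ≠ 3) && M.testBit i) || A.testBit i

def lsOpt (f : Fin 4 → Fin 4) (o' o : ℕ × ℕ) (A : ℕ) : Prop :=
  o.2 + 7 * lsBits A ≤ o'.2 + 3 ∧
  (∀ j : Fin 4, o'.1.testBit j = true → lsU o.1 A (f j) = true) ∧
  (lsU o.1 A (f 3) = true ∨ lsU o.1 A 3 = true ∨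
    ∀ i : Fin 4, i ≠ 3 → i ≠ f 3 → lsU o.1 A i = true)

instance (f : Fin 4 → Fin 4) (o' o : ℕ × ℕ) (A : ℕ) : Decidable (lsOpt f o' o A) := by
  unfold lsOpt; infer_instance

theorem ls_step_aux : ∀ n ∈ List.range 16, ∀ d : Fin 4, d ≠ 3 →
    ((lsTab.getD n []).getD d (0, 0)).1 < 16 ∧ ((lsTab.getD n []).getD d (0, 0)).2 < 12 ∧
    lsPerms.getD ((lsTab.getD n []).getD d (0, 0)).2 id 3 = d ∧
    ∀ o' ∈ lsCls.getD ((lsTab.getD n []).getD d (0, 0)).1 [], ∃ o ∈ lsCls.getD n [],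
      ∃ A ∈ List.range 16, lsOpt (lsPerms.getD ((lsTab.getD n []).getD d (0, 0)).2 id) o' o A := by
  decide +kernel

theorem ls_step (C : List (ℕ × ℕ)) (hC : C ∈ lsCls) (d : Fin 4) (hd : d ≠ 3) :
    ∃ C' ∈ lsCls, ∃ f ∈ lsPerms,
    f 3 = d ∧ ∀ o' ∈ C', ∃ o ∈ C, ∃ A ∈ List.range 16, lsOpt f o' o A := by
  obtain ⟨n, hn, rfl⟩ := List.getElem_of_mem hC
  have h16 : lsCls.length = 16 := rfl
  have h12 : lsPerms.length = 12 := rfl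
  obtain ⟨h1, h2, h3, h4⟩ := ls_step_aux n (List.mem_range.2 (h16 ▸ hn)) d hd
  rw [List.getD_eq_getElem lsCls [] hn] at h4
  refine ⟨_, ?_, _, ?_, h3, h4⟩
  · rw [List.getD_eq_getElem _ [] (by omega)]; exact List.getElem_mem _
  · rw [List.getD_eq_getElem _ id (by omega)]; exact List.getElem_mem _

theorem ls_perm : ∀ f ∈ lsPerms, Function.Injective f ∧ Function.Surjective f := by
  decide +kernel

theorem ls_final : ∀ C ∈ lsCls, ∃ o ∈ C, (o.2 ≤ 18 ∧ ∃ i : Fin 4, i ≠ 3 ∧ o.1.testBit i = true) ∨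
    o.2 ≤ 11 := by
  decide +kernel

theorem ls_base : ∃ C ∈ lsCls, ∀ o ∈ C, ∃ A ∈ List.range 16, 7 * lsBits A ≤ o.2 ∧
    (∀ j : Fin 4, o.1.testBit j = true → A.testBit j = true) ∧
    (A.testBit 3 = true ∨ ∃ i j : Fin 4, i ≠ j ∧ i ≠ 3 ∧ j ≠ 3 ∧ A.testBit i = true ∧ A.testBit j = true) := by
  decide +kernel

def lsSet (q : Fin 4 → ℕ) (A : ℕ) : Finset ℕ :=
  (Finset.univ.filter fun i : Fin 4 => A.testBit i = true).image q

theorem lsSet_card (q : Fin 4 → ℕ) (A : ℕ) : (lsSet q A).card ≤ lsBits A := by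
  refine le_trans Finset.card_image_le ?_
  rw [Finset.card_filter, Fin.sum_univ_four]
  simp only [lsBits, Bool.toNat, Fin.val_zero, Fin.val_one]
  have h2 : ((2 : Fin 4) : ℕ) = 2 := rfl
  have h3 : ((3 : Fin 4) : ℕ) = 3 := rfl
  rw [h2, h3]
  simp [Bool.cond_eq_ite]

theorem mem_lsSet {q : Fin 4 → ℕ} {A : ℕ} {i : Fin 4} (h : A.testBit i = true) :
    q i ∈ lsSet q A :=
  Finset.mem_image_of_mem q (by simpa using h)

theorem lsSet_subset {q : Fin 4 → ℕ} {A : ℕ} {V : Finset ℕ} (h : ∀ i, q i ∈ V) :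
    lsSet q A ⊆ V := by
  intro v hv
  obtain ⟨i, -, rfl⟩ := Finset.mem_image.1 hv
  exact h i

/-- A 3-subset of a 4-set containing two given elements contains one of the others. -/
theorem ls_hit {q : Fin 4 → ℕ} {R e : Finset ℕ} (hR : R = Finset.univ.image q)
    (he : e ⊆ R) (hc : e.card = 3) (a b : Fin 4) :
    ∃ i, i ≠ a ∧ i ≠ b ∧ q i ∈ e := by
  by_contra hcon
  push Not at hcon
  have : e ⊆ {q a, q b} := by
    intro v hv
    have := he hv
    rw [hR] at this
    obtain ⟨i, -, rfl⟩ := Finset.mem_image.1 this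
    by_cases h1 : i = a
    · simp [h1]
    by_cases h2 : i = b
    · simp [h2]
    exact absurd hv (hcon i h1 h2)
  have h := Finset.card_le_card this
  have := Finset.card_le_two (a := q a) (b := q b)
  omega

theorem ls_chain (m : ℕ) (ρ : ℕ → Finset ℕ) (V : Finset ℕ) (F : Set (Finset ℕ))
    (hV : ∀ k < m, ρ k ⊆ V)
    (hcard : ∀ k < m, (ρ k).card = 4)
    (hadj : ∀ k, k + 1 < m → (ρ k ∩ ρ (k + 1)).card = 3)
    (hno : ∀ k, k + 2 < m → ρ k ∩ ρ (k + 1) ≠ ρ (k + 1) ∩ ρ (k + 2))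
    (hF3 : ∀ e ∈ F, e.card = 3)
    (hFu : ∀ e ∈ F, ∀ i < m, ∀ j < m, e ⊆ ρ i → e ⊆ ρ j → i = j) :
    ∀ k < m, ∀ x ∈ ρ k, (∀ l, l + 1 = k → x ∈ ρ l) →
      ∃ C ∈ lsCls, ∃ p : Fin 4 → ℕ, Function.Injective p ∧ ρ k = Finset.univ.image p ∧ p 3 = x ∧
        ∀ o ∈ C, ∃ T ⊆ V, (∀ i : Fin 4, o.1.testBit i = true → p i ∈ T) ∧
          (∀ j < k, ∀ e ∈ F, e ⊆ ρ j → (T ∩ e).Nonempty) ∧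
          (∀ e ∈ F, e ⊆ ρ k → x ∈ e → (T ∩ e).Nonempty) ∧
          7 * T.card ≤ o.2 + 3 * k := by
  have hsd : ∀ (A B : Finset ℕ), A.card = 4 → (A ∩ B).card = 3 → ∃ y, A \ B = {y} := by
    intro A B h1 h2
    have := Finset.card_sdiff_add_card_inter A B
    exact Finset.card_eq_one.1 (by omega)
  intro k
  induction k with
  | zero =>
    intro hk x hx _
    obtain ⟨C, hC, hb⟩ := ls_base
    have h3 : ((ρ 0).erase x).card = 3 := by
      rw [Finset.card_erase_of_mem hx, hcard 0 hk]
    obtain ⟨a, b, c, hab, hac, hbc, habc⟩ := Finset.card_eq_three.1 h3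
    have hρ : ρ 0 = {x, a, b, c} := by rw [← habc, Finset.insert_erase hx]
    have hxn : x ∉ ({a, b, c} : Finset ℕ) := by rw [← habc]; simp
    simp only [Finset.mem_insert, Finset.mem_singleton, not_or] at hxn
    obtain ⟨hxa, hxb, hxc⟩ := hxn
    have himg : ρ 0 = Finset.univ.image ![a, b, c, x] := by
      rw [hρ]; ext v
      simp [Fin.exists_fin_succ, eq_comm]
      tauto
    have hinj : Function.Injective ![a, b, c, x] := by
      have h4 := hcard 0 hk
      rw [himg] at h4
      have h5 : Set.InjOn ![a, b, c, x] ((Finset.univ : Finset (Fin 4)) : Set (Fin 4)) :=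
        Finset.injOn_of_card_image_eq (by rw [h4]; simp)
      intro i j hij
      exact h5 (by simp) (by simp) hij
    refine ⟨C, hC, ![a, b, c, x], hinj, himg, rfl, ?_⟩
    generalize hp : ![a, b, c, x] = p at himg hinj
    have hp3 : p 3 = x := by rw [← hp]; rfl
    intro o ho
    obtain ⟨A, -, hA1, hA2, hA3⟩ := hb o ho
    refine ⟨lsSet p A, lsSet_subset ?_, fun i hi => mem_lsSet (hA2 i hi), ?_, ?_, ?_⟩
    · intro i; apply hV 0 hk; rw [himg]; simp
    · intro j hj; omega
    · intro e he heρ hxe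
      rcases hA3 with h | ⟨i, j, hij, hi3, hj3, hi, hj⟩
      · exact ⟨x, Finset.mem_inter.2 ⟨hp3 ▸ mem_lsSet h, hxe⟩⟩
      · -- the position outside `i, j, 3`
        have hl : ∃ l : Fin 4, ∀ t : Fin 4, t ≠ l → t ≠ 3 → t = i ∨ t = j := by
          clear hi hj; revert i j; decide +kernel
        obtain ⟨l, hl⟩ := hl
        obtain ⟨t, ht1, ht2, ht3⟩ := ls_hit himg heρ (hF3 e he) l 3
        rcases hl t ht1 ht2 with rfl | rfl
        · exact ⟨_, Finset.mem_inter.2 ⟨mem_lsSet hi, ht3⟩⟩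
        · exact ⟨_, Finset.mem_inter.2 ⟨mem_lsSet hj, ht3⟩⟩
    · have := lsSet_card p A
      omega
  | succ k ih =>
    intro hk x hx hxl
    have hxk : x ∈ ρ k := hxl k rfl
    obtain ⟨y, hy⟩ := hsd (ρ (k + 1)) (ρ k) (hcard _ hk) (by rw [Finset.inter_comm]; exact hadj k hk)
    obtain ⟨z, hz⟩ := hsd (ρ k) (ρ (k + 1)) (hcard _ (by omega)) (hadj k hk)
    have hy1 : y ∈ ρ (k + 1) ∧ y ∉ ρ k := by
      rw [← Finset.mem_sdiff, hy]; simp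
    have hz1 : z ∈ ρ k ∧ z ∉ ρ (k + 1) := by
      rw [← Finset.mem_sdiff, hz]; simp
    have hy2 : ∀ v ∈ ρ (k + 1), v ≠ y → v ∈ ρ k := by
      intro v hv hvy
      by_contra h
      have : v ∈ ρ (k + 1) \ ρ k := Finset.mem_sdiff.2 ⟨hv, h⟩
      rw [hy] at this
      exact hvy (by simpa using this)
    have hz2 : ∀ v ∈ ρ k, v ≠ z → v ∈ ρ (k + 1) := by
      intro v hv hvz
      by_contra h
      have : v ∈ ρ k \ ρ (k + 1) := Finset.mem_sdiff.2 ⟨hv, h⟩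
      rw [hz] at this
      exact hvz (by simpa using this)
    have hzl : ∀ l, l + 1 = k → z ∈ ρ l := by
      rintro l rfl
      by_contra hcon
      apply hno l hk
      have h1 : ρ l ∩ ρ (l + 1) ⊆ ρ (l + 1) ∩ ρ (l + 2) := by
        intro v hv
        obtain ⟨hv1, hv2⟩ := Finset.mem_inter.1 hv
        exact Finset.mem_inter.2 ⟨hv2, hz2 v hv2 (fun h => hcon (h ▸ hv1))⟩
      exact Finset.eq_of_subset_of_card_le h1
        (by rw [hadj l (by omega), hadj (l + 1) (by omega)])
    obtain ⟨C, hC, p, hpi, hpr, hp3, hopt⟩ := ih (by omega) z hz1.1 hzl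
    have hpm : ∀ i, p i ∈ ρ k := by intro i; rw [hpr]; simp
    -- the position of `x`
    obtain ⟨d, -, hd⟩ := Finset.mem_image.1 (hpr ▸ hxk : x ∈ Finset.univ.image p)
    have hd3 : d ≠ 3 := by
      rintro rfl
      exact hz1.2 (by rw [← hp3, hd]; exact hx)
    obtain ⟨C', hC', f, hf, hfd, hstep⟩ := ls_step C hC d hd3
    obtain ⟨hfi, hfs⟩ := ls_perm f hf
    set q : Fin 4 → ℕ := Function.update p 3 y with hq
    have hq3 : q 3 = y := by simp [hq]
    have hqn : ∀ i, i ≠ 3 → q i = p i := by intro i hi; simp [hq, hi]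
    have hqi : Function.Injective q := by
      intro i j hij
      by_cases hi : i = 3 <;> by_cases hj : j = 3
      · rw [hi, hj]
      · rw [hi, hq3, hqn j hj] at hij
        exact absurd (hij ▸ hpm j) hy1.2
      · rw [hj, hq3, hqn i hi] at hij
        exact absurd (hij ▸ hpm i) hy1.2
      · rw [hqn i hi, hqn j hj] at hij
        exact hpi hij
    have hqm : ∀ i, q i ∈ ρ (k + 1) := by
      intro i
      by_cases hi : i = 3
      · rw [hi, hq3]; exact hy1.1
      · rw [hqn i hi]
        refine hz2 _ (hpm i) ?_
        rw [← hp3]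
        exact fun h => hi (hpi h)
    have hqr : ρ (k + 1) = Finset.univ.image q := by
      symm
      apply Finset.eq_of_subset_of_card_le
      · intro v hv
        obtain ⟨i, -, rfl⟩ := Finset.mem_image.1 hv
        exact hqm i
      · rw [Finset.card_image_of_injective _ hqi, hcard _ hk]; simp
    refine ⟨C', hC', q ∘ f, hqi.comp hfi, ?_, ?_, ?_⟩
    · rw [hqr, ← Finset.image_image, Finset.image_univ_of_surjective hfs]
    · simp only [Function.comp]; rw [hfd, hqn d hd3, hd]
    intro o' ho'
    obtain ⟨o, ho, A, -, hA1, hA2, hA3⟩ := hstep o' ho'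
    obtain ⟨T, hTV, hT1, hT2, hT3, hT4⟩ := hopt o ho
    have hU : ∀ i, lsU o.1 A i = true → q i ∈ T ∪ lsSet q A := by
      intro i hi
      simp only [lsU, Bool.or_eq_true, Bool.and_eq_true, decide_eq_true_eq] at hi
      rcases hi with ⟨h1, h2⟩ | h
      · rw [hqn i h1]; exact Finset.mem_union_left _ (hT1 i h2)
      · exact Finset.mem_union_right _ (mem_lsSet h)
    have hmono : ∀ e : Finset ℕ, (T ∩ e).Nonempty → ((T ∪ lsSet q A) ∩ e).Nonempty :=
      fun e h => h.mono (Finset.inter_subset_inter_right Finset.subset_union_left)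
    refine ⟨T ∪ lsSet q A, ?_, ?_, ?_, ?_, ?_⟩
    · exact Finset.union_subset hTV (lsSet_subset fun i => hV _ hk (hqm i))
    · intro i hi
      exact hU _ (hA2 i hi)
    · intro j hj e he hej
      apply hmono
      rcases Nat.lt_succ_iff_lt_or_eq.1 hj with h | rfl
      · exact hT2 j h e he hej
      · refine hT3 e he hej ?_
        by_contra hze
        have : e ⊆ ρ (j + 1) := fun v hv => hz2 v (hej hv) (fun h => hze (h ▸ hv))
        have := hFu e he j (by omega) (j + 1) hk hej this
        omega
    · intro e he hek hxe
      have hye : y ∈ e := by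
        by_contra hye
        have : e ⊆ ρ k := fun v hv => hy2 v (hek hv) (fun h => hye (h ▸ hv))
        have := hFu e he k (by omega) (k + 1) hk this hek
        omega
      rcases hA3 with h | h | h
      · have := hU _ h
        rw [hfd, hqn d hd3, hd] at this
        exact ⟨x, Finset.mem_inter.2 ⟨this, hxe⟩⟩
      · have := hU _ h
        rw [hq3] at this
        exact ⟨y, Finset.mem_inter.2 ⟨this, hye⟩⟩
      · obtain ⟨i, hi1, hi2, hi3⟩ := ls_hit hqr hek (hF3 e he) 3 d
        exact ⟨_, Finset.mem_inter.2 ⟨hU i (h i hi1 (hfd ▸ hi2)), hi3⟩⟩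
    · have h1 := Finset.card_union_le T (lsSet q A)
      have h2 := lsSet_card q A
      omega

theorem ls_chain_final (m : ℕ) (hm : 0 < m) (ρ : ℕ → Finset ℕ) (V : Finset ℕ) (F : Set (Finset ℕ))
    (hV : ∀ k < m, ρ k ⊆ V)
    (hcard : ∀ k < m, (ρ k).card = 4)
    (hadj : ∀ k, k + 1 < m → (ρ k ∩ ρ (k + 1)).card = 3)
    (hno : ∀ k, k + 2 < m → ρ k ∩ ρ (k + 1) ≠ ρ (k + 1) ∩ ρ (k + 2))
    (hF3 : ∀ e ∈ F, e.card = 3)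
    (hFu : ∀ e ∈ F, ∀ i < m, ∀ j < m, e ⊆ ρ i → e ⊆ ρ j → i = j)
    (hFe : ∀ e ∈ F, ∃ i < m, e ⊆ ρ i) :
    ∃ T ⊆ V, IsTransversal T F ∧ 7 * T.card ≤ 3 * m + 15 := by
  obtain ⟨k, rfl⟩ : ∃ k, m = k + 1 := ⟨m - 1, by omega⟩
  have hx : ∃ x ∈ ρ k, ∀ l, l + 1 = k → x ∈ ρ l := by
    rcases k with _ | k
    · have : (ρ 0).Nonempty := Finset.card_pos.1 (by rw [hcard 0 (by omega)]; omega)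
      obtain ⟨x, hx⟩ := this
      exact ⟨x, hx, fun l hl => by omega⟩
    · have : (ρ k ∩ ρ (k + 1)).Nonempty := Finset.card_pos.1 (by rw [hadj k (by omega)]; omega)
      obtain ⟨x, hx⟩ := this
      obtain ⟨h1, h2⟩ := Finset.mem_inter.1 hx
      refine ⟨x, h2, fun l hl => ?_⟩
      obtain rfl : l = k := by omega
      exact h1
  obtain ⟨x, hx1, hx2⟩ := hx
  obtain ⟨C, hC, p, hpi, hpr, hp3, hopt⟩ :=
    ls_chain (k + 1) ρ V F hV hcard hadj hno hF3 hFu k (by omega) x hx1 hx2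
  have hpm : ∀ i, p i ∈ V := by
    intro i; apply hV k (by omega); rw [hpr]; simp
  have key : ∃ T ⊆ V, (∃ i, i ≠ 3 ∧ p i ∈ T) ∧
      (∀ j < k, ∀ e ∈ F, e ⊆ ρ j → (T ∩ e).Nonempty) ∧
      (∀ e ∈ F, e ⊆ ρ k → x ∈ e → (T ∩ e).Nonempty) ∧ 7 * T.card ≤ 18 + 3 * k := by
    obtain ⟨o, ho, ⟨h18, i, hi3, hi⟩ | h11⟩ := ls_final C hC
    · obtain ⟨T, hTV, hT1, hT2, hT3, hT4⟩ := hopt o ho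
      exact ⟨T, hTV, ⟨i, hi3, hT1 i hi⟩, hT2, hT3, by omega⟩
    · obtain ⟨T, hTV, hT1, hT2, hT3, hT4⟩ := hopt o ho
      have hmono : ∀ e : Finset ℕ, (T ∩ e).Nonempty → ((insert (p 0) T) ∩ e).Nonempty :=
        fun e h => h.mono (Finset.inter_subset_inter_right (Finset.subset_insert _ _))
      refine ⟨insert (p 0) T, Finset.insert_subset (hpm 0) hTV, ⟨0, by decide, by simp⟩,
        fun j hj e he h => hmono e (hT2 j hj e he h), fun e he h h' => hmono e (hT3 e he h h'), ?_⟩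
      have := Finset.card_insert_le (p 0) T
      omega
  obtain ⟨T, hTV, ⟨i, hi3, hi⟩, hT2, hT3, hT4⟩ := key
  refine ⟨T, hTV, ?_, by omega⟩
  intro e he
  obtain ⟨j, hj, hej⟩ := hFe e he
  rcases Nat.lt_succ_iff_lt_or_eq.1 hj with h | rfl
  · exact hT2 j h e he hej
  by_cases hxe : x ∈ e
  · exact hT3 e he hej hxe
  · have h1 : e ⊆ (ρ j).erase x := fun v hv =>
      Finset.mem_erase.2 ⟨fun h => hxe (h ▸ hv), hej hv⟩
    have h2 : e = (ρ j).erase x := Finset.eq_of_subset_of_card_le h1 (by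
      rw [Finset.card_erase_of_mem hx1, hcard j (by omega), hF3 e he])
    refine ⟨p i, Finset.mem_inter.2 ⟨hi, ?_⟩⟩
    rw [h2]
    refine Finset.mem_erase.2 ⟨?_, ?_⟩
    · rw [← hp3]; exact fun h => hi3 (hpi h)
    · rw [hpr]; simp

theorem ls_card (m : ℕ) (σ : Fin m → Finset ℕ) (hB : IsStackedBall 2 m σ) (hm : 0 < m) :
    m + 3 ≤ (vertexSet m σ).card := by
  have h : ∀ k, k < m → k + 4 ≤
      ((Finset.univ.filter fun i : Fin m => i.val ≤ k).biUnion σ).card := by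
    intro k
    induction k with
    | zero =>
      intro hk
      rw [← show (σ ⟨0, hk⟩).card = 0 + 4 from hB.1 _]
      exact Finset.card_le_card (Finset.subset_biUnion_of_mem σ (by simp))
    | succ k ih =>
      intro hk
      have ih := ih (by omega)
      obtain ⟨η, hη, hηs, -, hmem⟩ := hB.2 ⟨k + 1, hk⟩ (by simp)
      obtain ⟨v, hv, hvη⟩ : ∃ v ∈ σ ⟨k + 1, hk⟩, v ∉ η := by
        by_contra hcon
        push Not at hcon
        have h1 := Finset.card_le_card (show σ ⟨k + 1, hk⟩ ⊆ η from hcon)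
        rw [hB.1, hη] at h1
        omega
      have hvn : v ∉ (Finset.univ.filter fun i : Fin m => i.val ≤ k).biUnion σ := by
        intro hvb
        obtain ⟨i, hi, hvi⟩ := Finset.mem_biUnion.1 hvb
        have hi : i.val ≤ k := by simpa using hi
        have := (hmem {v} (by simpa using hv)).1 ⟨i, by simp; omega, by simpa using hvi⟩
        exact hvη (by simpa using this)
      have hsub : insert v ((Finset.univ.filter fun i : Fin m => i.val ≤ k).biUnion σ) ⊆
          (Finset.univ.filter fun i : Fin m => i.val ≤ k + 1).biUnion σ := by
        apply Finset.insert_subset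
        · exact Finset.mem_biUnion.2 ⟨⟨k + 1, hk⟩, by simp, hv⟩
        · apply Finset.biUnion_subset_biUnion_of_subset_left
          intro i hi
          simp only [Finset.mem_filter, Finset.mem_univ, true_and] at hi ⊢
          omega
      have := Finset.card_le_card hsub
      rw [Finset.card_insert_of_notMem hvn] at this
      omega
  have h1 := h (m - 1) (by omega)
  have h2 : ((Finset.univ.filter fun i : Fin m => i.val ≤ m - 1).biUnion σ).card ≤
      (vertexSet m σ).card :=
    Finset.card_le_card (Finset.biUnion_subset_biUnion_of_subset_left _ (Finset.filter_subset _ _))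
  omega

theorem ls_inj (m : ℕ) (σ : Fin m → Finset ℕ) (hB : IsStackedBall 2 m σ) (i j : Fin m)
    (hij : i < j) : σ i ≠ σ j := by
  intro h
  have hij' : i.val < j.val := hij
  obtain ⟨η, hη, hηs, -, hmem⟩ := hB.2 j (by omega)
  have h1 := (hmem (σ j) (Finset.Subset.refl _)).1 ⟨i, hij', h.ge⟩
  have h2 := Finset.card_le_card h1
  rw [hB.1, hη] at h2
  omega

/-- **Theorem (Upper bound).** Every linear stacked `2`-sphere `S` on `n ≥ 4` vertices
has a transversal of size at most `⌈3n/7⌉` (note `(3n + 6) / 7 = ⌈3n/7⌉` in `ℕ`). -/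
theorem linear_stacked_two_sphere_upper_bound (n : ℕ) (hn : 4 ≤ n)
    (m : ℕ) (σ : Fin m → Finset ℕ)
    (hB : IsStackedBall 2 m σ) (hL : IsLinear 2 m σ)
    (hV : (vertexSet m σ).card = n) :
    ∃ T : Finset ℕ, T ⊆ vertexSet m σ ∧ IsTransversal T (sphereFacets 2 m σ) ∧
      T.card ≤ (3 * n + 6) / 7 := by
  have hm : 0 < m := by
    rcases Nat.eq_zero_or_pos m with rfl | h
    · simp [vertexSet] at hV; omega
    · exact h
  have hmn := ls_card m σ hB hm
  obtain ⟨e, he⟩ := hL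
  have hinj : Function.Injective σ := by
    intro i j hij
    rcases lt_trichotomy i j with h | h | h
    · exact absurd hij (ls_inj m σ hB i j h)
    · exact h
    · exact absurd hij.symm (ls_inj m σ hB j i h)
  let ρ : ℕ → Finset ℕ := fun k => if h : k < m then σ (e.symm ⟨k, h⟩) else ∅
  have hρ : ∀ k (h : k < m), ρ k = σ (e.symm ⟨k, h⟩) := fun k h => dif_pos h
  have hadj : ∀ k, k + 1 < m → (ρ k ∩ ρ (k + 1)).card = 3 := by
    intro k hk
    rw [hρ k (by omega), hρ (k + 1) hk]
    exact ((he _ _).2 (by simp)).2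
  have hcard : ∀ k < m, (ρ k).card = 4 := by
    intro k hk; rw [hρ k hk]; exact hB.1 _
  obtain ⟨T, hT1, hT2, hT3⟩ := ls_chain_final m hm ρ (vertexSet m σ) (sphereFacets 2 m σ)
    (by
      intro k hk; rw [hρ k hk]
      exact Finset.subset_biUnion_of_mem σ (Finset.mem_univ _))
    hcard hadj
    (by
      intro k hk heq
      have hne : e.symm ⟨k, by omega⟩ ≠ e.symm ⟨k + 2, hk⟩ := by
        simp
      have hs : ρ k ∩ ρ (k + 1) ⊆ ρ k ∩ ρ (k + 2) := by
        intro v hv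
        have hv' := heq ▸ hv
        exact Finset.mem_inter.2 ⟨(Finset.mem_inter.1 hv).1, (Finset.mem_inter.1 hv').2⟩
      have h3 := Finset.card_le_card hs
      rw [hadj k (by omega)] at h3
      have h4 : (ρ k ∩ ρ (k + 2)).card ≤ 4 :=
        (Finset.card_le_card Finset.inter_subset_left).trans (hcard k (by omega)).le
      rcases Nat.lt_or_ge (ρ k ∩ ρ (k + 2)).card 4 with h | h
      · have h3' : (ρ k ∩ ρ (k + 2)).card = 3 := by omega
        rw [hρ k (by omega), hρ (k + 2) hk] at h3'
        have := (he _ _).1 ⟨hne, h3'⟩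
        simp at this
        omega
      · have e1 : ρ k ∩ ρ (k + 2) = ρ k := Finset.eq_of_subset_of_card_le
          Finset.inter_subset_left (by rw [hcard k (by omega)]; exact h)
        have e2 : ρ k ∩ ρ (k + 2) = ρ (k + 2) := Finset.eq_of_subset_of_card_le
          Finset.inter_subset_right (by rw [hcard (k + 2) hk]; exact h)
        have e3 : ρ k = ρ (k + 2) := e1.symm.trans e2
        rw [hρ k (by omega), hρ (k + 2) hk] at e3
        exact hne (hinj e3))
    (fun f hf => hf.1)
    (by
      intro f hf i hi j hj h1 h2
      rw [hρ i hi] at h1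
      rw [hρ j hj] at h2
      have := e.symm.injective (hf.2.unique h1 h2)
      exact Fin.mk.inj_iff.1 this)
    (by
      intro f hf
      obtain ⟨i, hi, -⟩ := hf.2
      refine ⟨(e i).val, (e i).isLt, ?_⟩
      rw [hρ _ (e i).isLt]
      simpa using hi)
  refine ⟨T, hT1, hT2, ?_⟩
  omega
end

section
/- For every integer k ≥ 1, there exists a stacked 2-sphere S on 13k vertices whose transversal number satisfies τ(S) ≥ 6k. -/
open Finset

def gE : ℕ → Finset ℕ
  | 0 => {0, 1, 2}
  | 1 => {0, 2, 3}
  | 2 => {1, 2, 3}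
  | 3 => {0, 2, 4}
  | 4 => {1, 2, 5}
  | 5 => {0, 1, 3}
  | 6 => {2, 5, 7}
  | 7 => {0, 4, 6}
  | 8 => {0, 1, 8}
  | 9 => {1, 8, 11}
  | 10 => {2, 3, 4}
  | 11 => {3, 4, 13}
  | _ => {4, 13, 14}

def gT (r : ℕ) : Finset ℕ := insert (r + 3) (gE r)

def gsh (q : ℕ) (f : Finset ℕ) : Finset ℕ := f.image (· + 13 * q)

def gS (j : ℕ) : Finset ℕ := gsh (j / 13) (gT (j % 13))

def gF : Finset (Finset ℕ) := {{0, 3, 4}, {1, 3, 5}, {2, 3, 5}, {0, 2, 6}, {2, 4, 6}, {1, 2, 7}, {1, 5, 7}, {0, 3, 8}, {1, 3, 8}, {2, 5, 9}, {2, 7, 9}, {5, 7, 9}, {0, 4, 10}, {0, 6, 10}, {4, 6, 10}, {0, 1, 11}, {0, 8, 11}, {1, 8, 12}, {1, 11, 12}, {8, 11, 12}}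

lemma gsh_mem (q : ℕ) (f : Finset ℕ) (x : ℕ) : x ∈ gsh q f ↔ ∃ y ∈ f, y + 13 * q = x := by
  simp [gsh]

lemma gsh_card (q : ℕ) (f : Finset ℕ) : (gsh q f).card = f.card :=
  Finset.card_image_of_injective _ (fun a b h => by simpa using h)

lemma gsh_sub (q : ℕ) (f g : Finset ℕ) : gsh q f ⊆ gsh q g ↔ f ⊆ g :=
  Finset.image_subset_image_iff (fun a b h => by simpa using h)

lemma gsh_gsh (q p : ℕ) (f : Finset ℕ) : gsh q (gsh p f) = gsh (p + q) f := by
  ext x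
  simp only [gsh_mem]
  constructor
  · rintro ⟨y, ⟨z, hz, rfl⟩, rfl⟩
    exact ⟨z, hz, by ring⟩
  · rintro ⟨z, hz, rfl⟩
    exact ⟨_, ⟨z, hz, rfl⟩, by ring⟩

lemma gT_lt : ∀ r < 13, ∀ x ∈ gT r, x ≤ r + 3 := by decide
lemma gE_lt : ∀ r < 13, ∀ x ∈ gE r, x < r + 3 := by decide
lemma gE_card : ∀ r < 13, (gE r).card = 3 := by decide
lemma gT_card : ∀ r < 13, (gT r).card = 4 := by decide

lemma gS_le (j x : ℕ) (h : x ∈ gS j) : x ≤ j + 3 ∧ 13 * (j / 13) ≤ x := by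
  obtain ⟨y, hy, rfl⟩ := (gsh_mem _ _ _).1 h
  have := gT_lt (j % 13) (by omega) y hy
  omega

lemma gS_top (j : ℕ) : j + 3 ∈ gS j :=
  (gsh_mem _ _ _).2 ⟨j % 13 + 3, by simp [gT], by omega⟩

lemma g_window (q i : ℕ) (f : Finset ℕ) (hne : f.Nonempty) (hp : i / 13 ≤ q)
    (h : gsh q f ⊆ gS i) :
    (i / 13 = q ∧ f ⊆ gT (i % 13)) ∨ (i / 13 + 1 = q ∧ gsh 1 f ⊆ gT (i % 13)) := by
  obtain ⟨y, hy⟩ := hne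
  have h1 := gS_le i _ (h ((gsh_mem _ _ _).2 ⟨y, hy, rfl⟩))
  have : i / 13 = q ∨ i / 13 + 1 = q := by omega
  rcases this with hq | hq
  · left
    refine ⟨hq, ?_⟩
    rw [gS, hq, gsh_sub] at h
    exact h
  · right
    refine ⟨hq, ?_⟩
    rw [gS, ← hq, add_comm, ← gsh_gsh, gsh_sub] at h
    exact h

set_option synthInstance.maxHeartbeats 400000 in
set_option synthInstance.maxSize 4096 in
set_option maxRecDepth 10000 in
lemma gE_chk : ∀ r < 13, 0 < r → ∃ s < r, gE r ⊆ gT s ∧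
    ∀ t < 13, ((t < r → gE r ⊆ gT t → t = s) ∧ ¬ gsh 1 (gE r) ⊆ gT t) := by decide +kernel

lemma gE_chk0 : gsh 1 (gE 0) ⊆ gT 12 ∧ ∀ t < 13, gsh 1 (gE 0) ⊆ gT t → t = 12 := by
  decide +kernel

lemma gE_uniq (j : ℕ) (hj : 0 < j) : ∃ i < j, gsh (j / 13) (gE (j % 13)) ⊆ gS i ∧
    ∀ i' < j, gsh (j / 13) (gE (j % 13)) ⊆ gS i' → i' = i := by
  have hne : (gE (j % 13)).Nonempty := by
    rw [← Finset.card_pos, gE_card _ (by omega)]; norm_num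
  by_cases hr : 0 < j % 13
  · obtain ⟨s, hs, h1, h2⟩ := gE_chk (j % 13) (by omega) hr
    refine ⟨13 * (j / 13) + s, by omega, ?_, ?_⟩
    · rw [gS, show (13 * (j / 13) + s) / 13 = j / 13 by omega,
        show (13 * (j / 13) + s) % 13 = s by omega, gsh_sub]
      exact h1
    · intro i hi h
      rcases g_window _ i _ hne (by omega) h with ⟨hq, h⟩ | ⟨hq, h⟩
      · have := (h2 (i % 13) (by omega)).1 (by omega) h
        omega
      · exact absurd h (h2 (i % 13) (by omega)).2
  · have hr : j % 13 = 0 := by omega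
    rw [hr] at hne ⊢
    refine ⟨j - 1, by omega, ?_, ?_⟩
    · rw [gS, show (j - 1) % 13 = 12 by omega, show j / 13 = 1 + (j - 1) / 13 by omega,
        ← gsh_gsh, gsh_sub]
      exact gE_chk0.1
    · intro i hi h
      rcases g_window _ i _ hne (by omega) h with ⟨hq, h⟩ | ⟨hq, h⟩
      · omega
      · have := gE_chk0.2 (i % 13) (by omega) h
        omega

lemma gF_chk : ∀ f ∈ gF, f.card = 3 ∧ (∀ x ∈ f, x < 13) ∧ ∃ r < 10, f ⊆ gT r ∧
    ∀ t < 13, ((f ⊆ gT t → t = r) ∧ ¬ gsh 1 f ⊆ gT t) := by decide +kernel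

lemma gF_facet (k q : ℕ) (hq : q < k) (f : Finset ℕ) (hf : f ∈ gF) :
    gsh q f ∈ sphereFacets 2 (13 * k - 3) (fun i => gS i.val) := by
  obtain ⟨hc, hlt, r, hr, h1, h2⟩ := gF_chk f hf
  have hne : f.Nonempty := by rw [← Finset.card_pos, hc]; norm_num
  refine ⟨by rw [gsh_card, hc], ⟨13 * q + r, by omega⟩, ?_, ?_⟩
  · show gsh q f ⊆ gS (13 * q + r)
    rw [gS, show (13 * q + r) / 13 = q by omega,
        show (13 * q + r) % 13 = r by omega, gsh_sub]
    exact h1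
  · rintro ⟨i, hi⟩ h
    change gsh q f ⊆ gS i at h
    have hp : i / 13 ≤ q := by
      obtain ⟨y, hy⟩ := hne
      have h3 := gS_le i _ (h ((gsh_mem _ _ _).2 ⟨y, hy, rfl⟩))
      have := hlt y hy
      omega
    apply Fin.ext
    show i = 13 * q + r
    rcases g_window _ i _ hne hp h with ⟨hq, h⟩ | ⟨hq, h⟩
    · have := (h2 (i % 13) (by omega)).1 h
      omega
    · exact absurd h (h2 (i % 13) (by omega)).2

set_option synthInstance.maxHeartbeats 400000 in
set_option synthInstance.maxSize 4096 in
set_option maxRecDepth 10000 in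
lemma g_bool : ∀ b0 b1 b2 b3 b4 b5 b6 b7 b8 b9 b10 b11 b12 : Bool,
    (b0 || b3 || b4) = true →
    (b1 || b3 || b5) = true →
    (b2 || b3 || b5) = true →
    (b0 || b2 || b6) = true →
    (b2 || b4 || b6) = true →
    (b1 || b2 || b7) = true →
    (b1 || b5 || b7) = true →
    (b0 || b3 || b8) = true →
    (b1 || b3 || b8) = true →
    (b2 || b5 || b9) = true →
    (b2 || b7 || b9) = true →
    (b5 || b7 || b9) = true →
    (b0 || b4 || b10) = true →
    (b0 || b6 || b10) = true →
    (b4 || b6 || b10) = true →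
    (b0 || b1 || b11) = true →
    (b0 || b8 || b11) = true →
    (b1 || b8 || b12) = true →
    (b1 || b11 || b12) = true →
    (b8 || b11 || b12) = true →
    6 ≤ b0.toNat + b1.toNat + b2.toNat + b3.toNat + b4.toNat + b5.toNat + b6.toNat + b7.toNat
      + b8.toNat + b9.toNat + b10.toNat + b11.toNat + b12.toNat := by
  decide +kernel

lemma g_block (T : Finset ℕ) (q : ℕ) (h : ∀ f ∈ gF, (T ∩ gsh q f).Nonempty) :
    6 ≤ ∑ i ∈ range 13, (decide (i + 13 * q ∈ T)).toNat := by
  have key : ∀ x y z : ℕ, ({x, y, z} : Finset ℕ) ∈ gF →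
      (decide (x + 13 * q ∈ T) || decide (y + 13 * q ∈ T) || decide (z + 13 * q ∈ T)) = true := by
    intro x y z hf
    obtain ⟨v, hv⟩ := h _ hf
    obtain ⟨hv1, hv2⟩ := Finset.mem_inter.1 hv
    obtain ⟨w, hw, rfl⟩ := (gsh_mem _ _ _).1 hv2
    simp only [Finset.mem_insert, Finset.mem_singleton] at hw
    rcases hw with rfl | rfl | rfl <;> simp [hv1]
  simp only [Finset.sum_range_succ, Finset.sum_range_zero, Nat.zero_add]
  have := g_bool (decide (0 + 13 * q ∈ T)) (decide (1 + 13 * q ∈ T)) (decide (2 + 13 * q ∈ T))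
    (decide (3 + 13 * q ∈ T)) (decide (4 + 13 * q ∈ T)) (decide (5 + 13 * q ∈ T))
    (decide (6 + 13 * q ∈ T)) (decide (7 + 13 * q ∈ T)) (decide (8 + 13 * q ∈ T))
    (decide (9 + 13 * q ∈ T)) (decide (10 + 13 * q ∈ T)) (decide (11 + 13 * q ∈ T))
    (decide (12 + 13 * q ∈ T))
    (key 0 3 4 (by decide))
    (key 1 3 5 (by decide))
    (key 2 3 5 (by decide))
    (key 0 2 6 (by decide))
    (key 2 4 6 (by decide))
    (key 1 2 7 (by decide))
    (key 1 5 7 (by decide))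
    (key 0 3 8 (by decide))
    (key 1 3 8 (by decide))
    (key 2 5 9 (by decide))
    (key 2 7 9 (by decide))
    (key 5 7 9 (by decide))
    (key 0 4 10 (by decide))
    (key 0 6 10 (by decide))
    (key 4 6 10 (by decide))
    (key 0 1 11 (by decide))
    (key 0 8 11 (by decide))
    (key 1 8 12 (by decide))
    (key 1 11 12 (by decide))
    (key 8 11 12 (by decide))
  simpa only [Nat.zero_add] using this

lemma g_sum (T : Finset ℕ) (k : ℕ) (h : ∀ q < k, ∀ f ∈ gF, (T ∩ gsh q f).Nonempty) :
    6 * k ≤ ∑ i ∈ range (13 * k), (decide (i ∈ T)).toNat := by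
  induction k with
  | zero => simp
  | succ k ih =>
    have h1 := ih (fun q hq => h q (by omega))
    have h2 := g_block T k (h k (by omega))
    rw [Nat.mul_succ 13 k, Finset.sum_range_add]
    simp only [add_comm (13 * k)]
    omega

lemma g_card (T : Finset ℕ) (n : ℕ) : ∑ i ∈ range n, (decide (i ∈ T)).toNat ≤ T.card := by
  have : ∀ i, (decide (i ∈ T)).toNat = if i ∈ T then 1 else 0 := by
    intro i; by_cases h : i ∈ T <;> simp [h]
  simp only [this]
  rw [← Finset.card_filter]
  exact Finset.card_le_card (fun x hx => (Finset.mem_filter.1 hx).2)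

/-- **Theorem (Lower bound, `d = 2`).** For every integer `k ≥ 1`, there exists a
stacked `2`-sphere `S` on `13k` vertices with `τ(S) ≥ 6k`. -/
theorem stacked_two_sphere_lower_bound (k : ℕ) (hk : 1 ≤ k) :
    ∃ (m : ℕ) (σ : Fin m → Finset ℕ),
      IsStackedBall 2 m σ ∧
      (vertexSet m σ).card = 13 * k ∧
      6 * k ≤ tau (sphereFacets 2 m σ) := by
  refine ⟨13 * k - 3, fun i => gS i.val, ⟨?_, ?_⟩, ?_, ?_⟩
  · intro i
    show (gS i.val).card = 4
    rw [gS, gsh_card, gT_card _ (by omega)]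
  · rintro ⟨j, hj⟩ hpos
    change 0 < j at hpos
    obtain ⟨i, hi, h1, h2⟩ := gE_uniq j hpos
    have hsub : gsh (j / 13) (gE (j % 13)) ⊆ gS j := by
      rw [gS, gsh_sub]; exact Finset.subset_insert _ _
    refine ⟨gsh (j / 13) (gE (j % 13)), ?_, hsub, ⟨⟨i, by omega⟩, ⟨hi, h1⟩, ?_⟩, ?_⟩
    · rw [gsh_card, gE_card _ (by omega)]
    · rintro ⟨i', hi'⟩ ⟨h3, h4⟩
      exact Fin.ext (h2 i' h3 h4)
    · intro τ hτ
      change τ ⊆ gS j at hτ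
      constructor
      · rintro ⟨⟨i', hi'⟩, h3, h4⟩ x hx
        change i' < j at h3
        change τ ⊆ gS i' at h4
        have h5 := gS_le _ _ (h4 hx)
        obtain ⟨y, hy, rfl⟩ := (gsh_mem _ _ _).1 (hτ hx)
        rw [gT, Finset.mem_insert] at hy
        rcases hy with rfl | hy
        · omega
        · exact (gsh_mem _ _ _).2 ⟨y, hy, rfl⟩
      · intro h
        exact ⟨⟨i, by omega⟩, hi, h.trans h1⟩
  · have : vertexSet (13 * k - 3) (fun i => gS i.val) = range (13 * k) := by
      ext x
      simp only [vertexSet, Finset.mem_biUnion, Finset.mem_univ, true_and, Finset.mem_range]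
      constructor
      · rintro ⟨⟨i, hi⟩, h⟩
        have := gS_le i x h
        omega
      · intro hx
        by_cases h3 : 3 ≤ x
        · refine ⟨⟨x - 3, by omega⟩, ?_⟩
          have := gS_top (x - 3)
          rwa [show x - 3 + 3 = x by omega] at this
        · refine ⟨⟨0, by omega⟩, ?_⟩
          show x ∈ gS 0
          have : x < 3 := by omega
          interval_cases x <;> decide
    rw [this, Finset.card_range]
  · apply le_csInf
    · refine ⟨_, range (13 * k), rfl, ?_⟩
      rintro f ⟨hc, ⟨i, hi⟩, hf, -⟩
      obtain ⟨x, hx⟩ : f.Nonempty := by rw [← Finset.card_pos, hc]; norm_num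
      have := gS_le i x (hf hx)
      exact ⟨x, Finset.mem_inter.2 ⟨Finset.mem_range.2 (by omega), hx⟩⟩
    · rintro n ⟨T, rfl, hT⟩
      exact (g_sum T k (fun q hq f hf => hT _ (gF_facet k q hq f hf))).trans (g_card T _)
end

section
/- For all integers d ≥ 2 and k ≥ 1, there exists a stacked d-sphere S on (d+2)²k vertices whose transversal number satisfies τ(S) ≥ (2d+3)k. -/
open Finset

/-- Facet families obtained from the boundary of a simplex by successive stellar subdivisions. -/
inductive Sp (n : ℕ) : ℕ → Set (Finset ℕ) → Prop
  | base : Sp n n {f | ∃ w < n, f = (range n).erase w}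
  | step (N : ℕ) (F : Set (Finset ℕ)) (f : Finset ℕ) (h : Sp n N F) (hf : f ∈ F) :
      Sp n (N + 1) {g | (g ∈ F ∧ g ≠ f) ∨ ∃ w ∈ f, g = insert N (f.erase w)}

def IB (d N : ℕ) (F : Set (Finset ℕ)) (m : ℕ) (σ : ℕ → Finset ℕ) : Prop :=
  (∀ i < m, (σ i).card = d + 2 ∧ σ i ⊆ range N) ∧
  (∀ k < m, 0 < k → ∃ η : Finset ℕ, η.card = d + 1 ∧ η ⊆ σ k ∧
    (∃ i < k, η ⊆ σ i ∧ ∀ j < k, η ⊆ σ j → j = i) ∧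
    ∀ τ ⊆ σ k, ((∃ i < k, τ ⊆ σ i) ↔ τ ⊆ η)) ∧
  (∀ v < N, ∃ i < m, v ∈ σ i) ∧
  (∀ f ∈ F, f.card = d + 1 ∧ ∃ i < m, f ⊆ σ i ∧ ∀ j < m, f ⊆ σ j → j = i)

theorem sp_ib (d N : ℕ) (F : Set (Finset ℕ)) (h : Sp (d + 2) N F) :
    ∃ m σ, IB d N F m σ := by
  induction h with
  | base =>
    refine ⟨1, fun _ => range (d + 2), ?_, ?_, ?_, ?_⟩
    · intro i _; simp
    · intro k hk hk'; omega
    · intro v hv; exact ⟨0, by simp, by simpa using hv⟩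
    · rintro f ⟨w, hw, rfl⟩
      refine ⟨?_, 0, by simp, Finset.erase_subset _ _, ?_⟩
      · rw [card_erase_of_mem (by simpa using hw)]; simp
      · intro j hj _; omega
  | step N F f h hf ih =>
    obtain ⟨m, σ, h1, h2, h3, h4⟩ := ih
    obtain ⟨hfc, i0, hi0, hfi, hfu⟩ := h4 f hf
    have hfN : f ⊆ range N := hfi.trans (h1 i0 hi0).2
    have hNf : N ∉ f := fun hh => by simpa using hfN hh
    have hNσ : ∀ i < m, N ∉ σ i := fun i hi hh => by simpa using (h1 i hi).2 hh
    have e1 : ∀ i < m, Function.update σ m (insert N f) i = σ i := fun i hi =>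
      Function.update_of_ne (by omega) _ _
    have e2 : Function.update σ m (insert N f) m = insert N f := Function.update_self _ _ _
    generalize Function.update σ m (insert N f) = σ' at e1 e2
    refine ⟨m + 1, σ', ?_, ?_, ?_, ?_⟩
    · intro i hi
      rcases Nat.lt_succ_iff_lt_or_eq.mp hi with hi | rfl
      · rw [e1 i hi]
        exact ⟨(h1 i hi).1, (h1 i hi).2.trans (range_subset_range.mpr (by omega))⟩
      · rw [e2, card_insert_of_notMem hNf, hfc]
        refine ⟨rfl, ?_⟩
        intro x hx
        rcases mem_insert.mp hx with rfl | hx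
        · simp
        · have := hfN hx
          simp at this ⊢; omega
    · intro k hk hk0
      rcases Nat.lt_succ_iff_lt_or_eq.mp hk with hk | rfl
      · obtain ⟨η, a1, a2, ⟨i, hi, hηi, hu⟩, a4⟩ := h2 k hk hk0
        refine ⟨η, a1, by rwa [e1 k hk], ⟨i, hi, by rwa [e1 i (by omega)], ?_⟩, ?_⟩
        · intro j hj hj'
          rw [e1 j (by omega)] at hj'
          exact hu j hj hj'
        · intro τ hτ
          rw [e1 k hk] at hτ
          rw [← a4 τ hτ]
          constructor
          · rintro ⟨j, hj, hj'⟩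
            rw [e1 j (by omega)] at hj'
            exact ⟨j, hj, hj'⟩
          · rintro ⟨j, hj, hj'⟩
            exact ⟨j, hj, by rwa [e1 j (by omega)]⟩
      · refine ⟨f, hfc, by rw [e2]; exact subset_insert _ _, ⟨i0, hi0, by rwa [e1 i0 hi0], ?_⟩, ?_⟩
        · intro j hj hj'
          rw [e1 j hj] at hj'
          exact hfu j hj hj'
        · intro τ hτ
          rw [e2] at hτ
          constructor
          · rintro ⟨j, hj, hj'⟩
            rw [e1 j hj] at hj'
            exact (subset_insert_iff_of_notMem (fun hh => hNσ j hj (hj' hh))).mp hτ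
          · intro hh
            exact ⟨i0, hi0, by rw [e1 i0 hi0]; exact hh.trans hfi⟩
    · intro v hv
      rcases Nat.lt_succ_iff_lt_or_eq.mp hv with hv | rfl
      · obtain ⟨i, hi, hvi⟩ := h3 v hv
        exact ⟨i, by omega, by rwa [e1 i hi]⟩
      · exact ⟨m, by omega, by rw [e2]; exact mem_insert_self _ _⟩
    · rintro g (⟨hg, hgf⟩ | ⟨w, hw, rfl⟩)
      · obtain ⟨c, i, hi, gi, gu⟩ := h4 g hg
        refine ⟨c, i, by omega, by rwa [e1 i hi], ?_⟩
        intro j hj hj'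
        rcases Nat.lt_succ_iff_lt_or_eq.mp hj with hj | rfl
        · rw [e1 j hj] at hj'
          exact gu j hj hj'
        · rw [e2] at hj'
          have : g ⊆ f := (subset_insert_iff_of_notMem (fun hh => hNσ i hi (gi hh))).mp hj'
          exact absurd (eq_of_subset_of_card_le this (by omega)) hgf
      · refine ⟨?_, m, by omega, ?_, ?_⟩
        · rw [card_insert_of_notMem (fun hh => hNf (mem_of_mem_erase hh)), card_erase_of_mem hw, hfc]
          omega
        · rw [e2]; exact insert_subset_insert _ (erase_subset _ _)
        · intro j hj hj'
          rcases Nat.lt_succ_iff_lt_or_eq.mp hj with hj | rfl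
          · rw [e1 j hj] at hj'
            exact absurd (hj' (mem_insert_self _ _)) (hNσ j hj)
          · rfl

theorem sp_final (d N : ℕ) (F : Set (Finset ℕ)) (h : Sp (d + 2) N F) :
    ∃ (m : ℕ) (σ : Fin m → Finset ℕ), IsStackedBall d m σ ∧ vertexSet m σ = range N ∧
      F ⊆ sphereFacets d m σ := by
  obtain ⟨m, σ, h1, h2, h3, h4⟩ := sp_ib d N F h
  refine ⟨m, fun i => σ i, ⟨fun i => (h1 i i.2).1, ?_⟩, ?_, ?_⟩
  · intro k hk
    obtain ⟨η, a1, a2, ⟨i, hi, hηi, hu⟩, a4⟩ := h2 k k.2 hk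
    refine ⟨η, a1, a2, ⟨⟨i, by omega⟩, ⟨hi, hηi⟩, ?_⟩, ?_⟩
    · rintro j ⟨hj, hj'⟩
      exact Fin.ext (hu j hj hj')
    · intro τ hτ
      rw [← a4 τ hτ]
      constructor
      · rintro ⟨i, hi, hh⟩; exact ⟨i, hi, hh⟩
      · rintro ⟨i, hi, hh⟩; exact ⟨⟨i, by omega⟩, hi, hh⟩
  · ext v
    simp only [vertexSet, mem_biUnion, mem_univ, true_and]
    constructor
    · rintro ⟨i, hi⟩; exact (h1 i i.2).2 hi
    · intro hv
      obtain ⟨i, hi, hh⟩ := h3 v (by simpa using hv)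
      exact ⟨⟨i, hi⟩, hh⟩
  · intro f hf
    obtain ⟨c, i, hi, hfi, hu⟩ := h4 f hf
    exact ⟨c, ⟨i, hi⟩, hfi, fun j hj => Fin.ext (hu j j.2 hj)⟩

theorem sp_sub {n N : ℕ} {F : Set (Finset ℕ)} (h : Sp n N F) : ∀ f ∈ F, f ⊆ range N := by
  induction h with
  | base => rintro f ⟨w, hw, rfl⟩; exact erase_subset _ _
  | step N F f h hf ih =>
    rintro g (⟨hg, -⟩ | ⟨w, hw, rfl⟩)
    · exact (ih g hg).trans (range_subset_range.mpr (by omega))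
    · intro x hx
      rcases mem_insert.mp hx with rfl | hx
      · simp
      · have := ih f hf (mem_of_mem_erase hx)
        simp at this ⊢; omega

theorem sp_card {n N : ℕ} {F : Set (Finset ℕ)} (h : Sp n N F) : ∀ f ∈ F, f.card + 1 = n := by
  induction h with
  | base =>
    rintro f ⟨w, hw, rfl⟩
    rw [card_erase_of_mem (by simpa using hw), card_range]; omega
  | step N F f h hf ih =>
    rintro g (⟨hg, -⟩ | ⟨w, hw, rfl⟩)
    · exact ih g hg
    · have hN : N ∉ f := fun hh => by simpa using sp_sub h f hf hh
      rw [card_insert_of_notMem (fun hh => hN (mem_of_mem_erase hh)), card_erase_of_mem hw]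
      have := ih f hf
      have := card_pos.mpr ⟨w, hw⟩
      omega

theorem sp_step {n N : ℕ} {F : Set (Finset ℕ)} (h : Sp n N F) {f : Finset ℕ} (hf : f ∈ F) :
    ∃ F', Sp n (N + 1) F' ∧ (∀ g ∈ F, g ≠ f → g ∈ F') ∧ ∀ w ∈ f, insert N (f.erase w) ∈ F' :=
  ⟨_, Sp.step N F f h hf, fun _ hg hgf => Or.inl ⟨hg, hgf⟩, fun w hw => Or.inr ⟨w, hw, rfl⟩⟩

theorem sp_ne {n N : ℕ} {F : Set (Finset ℕ)} (h : Sp n N F) {g f : Finset ℕ} (hg : g ∈ F)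
    {v : ℕ} (hv : v ∈ f) (hN : N ≤ v) : g ≠ f := by
  rintro rfl
  have := sp_sub h _ hg hv
  simp at this; omega

/-- Drop all old vertices but `x, y`. -/
theorem sp_phase {n : ℕ} (x y : ℕ) (hxy : x ≠ y) (m : ℕ) :
    ∀ (N : ℕ) (F : Set (Finset ℕ)) (R : Finset ℕ) (c : ℕ), Sp n N F → R ∪ Ico c N ∈ F →
      R ⊆ range c → c ≤ N → R.card = m + 2 → x ∈ R → y ∈ R →
      ∃ F', Sp n (N + m) F' ∧ ({x, y} ∪ Ico c (N + m)) ∈ F' ∧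
        ∀ g ∈ F, g ≠ R ∪ Ico c N → g ∈ F' := by
  induction m with
  | zero =>
    intro N F R c h hf hR hc hcard hx hy
    have : ({x, y} : Finset ℕ) = R := by
      apply eq_of_subset_of_card_le
      · intro z hz; simp at hz; rcases hz with rfl | rfl <;> assumption
      · rw [hcard, card_pair hxy]
    exact ⟨F, h, by rw [this]; exact hf, fun g hg _ => hg⟩
  | succ m ih =>
    intro N F R c h hf hR hc hcard hx hy
    obtain ⟨w, hw, hwn⟩ : ∃ w ∈ R, w ∉ ({x, y} : Finset ℕ) := by
      apply exists_mem_notMem_of_card_lt_card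
      rw [hcard, card_pair hxy]; omega
    simp only [mem_insert, mem_singleton, not_or] at hwn
    have hwc : w < c := by simpa using hR hw
    obtain ⟨F1, s1, p1, q1⟩ := sp_step h hf
    have hnew := q1 w (mem_union_left _ hw)
    have heq : insert N ((R ∪ Ico c N).erase w) = R.erase w ∪ Ico c (N + 1) := by
      ext z
      simp only [mem_insert, mem_erase, mem_union, mem_Ico]
      constructor
      · rintro (rfl | ⟨a, b | b⟩)
        · right; omega
        · left; exact ⟨a, b⟩
        · right; omega
      · rintro (⟨a, b⟩ | b)
        · exact Or.inr ⟨a, Or.inl b⟩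
        · by_cases hz : z = N
          · exact Or.inl hz
          · exact Or.inr ⟨by omega, Or.inr (by omega)⟩
    rw [heq] at hnew
    obtain ⟨F2, s2, f2, p2⟩ := ih (N + 1) F1 (R.erase w) c s1 hnew
      ((erase_subset _ _).trans hR) (by omega) (by rw [card_erase_of_mem hw]; omega)
      (mem_erase.mpr ⟨fun e => hwn.1 e.symm, hx⟩) (mem_erase.mpr ⟨fun e => hwn.2 e.symm, hy⟩)
    have e : N + 1 + m = N + (m + 1) := by omega
    rw [e] at s2 f2
    refine ⟨F2, s2, f2, fun g hg hne => p2 g (p1 g hg hne) ?_⟩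
    exact sp_ne h hg (v := N) (by simp; omega) le_rfl

def ArmFacets (n c x y : ℕ) : Set (Finset ℕ) :=
  {f | (∃ w, c ≤ w ∧ w + 1 < c + n ∧ f = (Ico c (c + n)).erase w) ∨
    f = insert x (Ico (c + 1) (c + n - 1)) ∨ f = insert y (Ico c (c + n - 2))}

theorem sp_arm {n N : ℕ} (hn : 4 ≤ n) {F : Set (Finset ℕ)} (h : Sp n N F) {f : Finset ℕ}
    (hf : f ∈ F) (x y p : ℕ) (hx : x ∈ f) (hy : y ∈ f) (hp : p ∈ f) (hxy : x ≠ y)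
    (hpx : p ≠ x) (hpy : p ≠ y) :
    ∃ F', Sp n (N + n) F' ∧ (∀ g ∈ F, g ≠ f → g ∈ F') ∧ ArmFacets n N x y ⊆ F' ∧
      ∀ w ∈ f, w ≠ p → insert N (f.erase w) ∈ F' := by
  obtain ⟨q, rfl⟩ : ∃ q, n = q + 4 := ⟨n - 4, by omega⟩
  have hfN := sp_sub h f hf
  have hfc := sp_card h f hf
  have hxN : x < N := by simpa using hfN hx
  have hyN : y < N := by simpa using hfN hy
  obtain ⟨F1, s1, p1, q1⟩ := sp_step h hf
  have e1 : insert N (f.erase p) = f.erase p ∪ Ico N (N + 1) := by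
    ext z; simp only [mem_insert, mem_union, mem_Ico]
    constructor
    · rintro (a | a)
      · right; omega
      · left; exact a
    · rintro (a | a)
      · right; exact a
      · left; omega
  have hm1 := q1 p hp
  rw [e1] at hm1
  obtain ⟨F2, s2, m2, p2⟩ := sp_phase x y hxy q (N + 1) F1 (f.erase p) N s1 hm1
    ((erase_subset _ _).trans hfN) (by omega) (by rw [card_erase_of_mem hp]; omega)
    (mem_erase.mpr ⟨hpx.symm, hx⟩) (mem_erase.mpr ⟨hpy.symm, hy⟩)
  obtain ⟨F3, s3, p3, q3⟩ := sp_step s2 m2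
  have k3 := q3 x (by simp)
  have m3 := q3 y (by simp)
  have e3 : insert (N + 1 + q) (({x, y} ∪ Ico N (N + 1 + q)).erase x)
      = insert y (Ico N (N + (q + 4) - 2)) := by
    ext z; simp only [mem_insert, mem_union, mem_Ico, mem_erase, mem_singleton]; omega
  have e3' : insert (N + 1 + q) (({x, y} ∪ Ico N (N + 1 + q)).erase y)
      = insert x (Ico N (N + q + 2)) := by
    ext z; simp only [mem_insert, mem_union, mem_Ico, mem_erase, mem_singleton]; omega
  rw [e3] at k3
  rw [e3'] at m3
  obtain ⟨F4, s4, p4, q4⟩ := sp_step s3 m3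
  have k4 := q4 N (by simp; omega)
  have m4 := q4 x (by simp)
  have e4 : insert (N + 1 + q + 1) ((insert x (Ico N (N + q + 2))).erase N)
      = insert x (Ico (N + 1) (N + (q + 4) - 1)) := by
    ext z; simp only [mem_insert, mem_Ico, mem_erase]; omega
  have e4' : insert (N + 1 + q + 1) ((insert x (Ico N (N + q + 2))).erase x)
      = Ico N (N + q + 3) := by
    ext z; simp only [mem_insert, mem_Ico, mem_erase]; omega
  rw [e4] at k4
  rw [e4'] at m4
  obtain ⟨F5, s5, p5, q5⟩ := sp_step s4 m4
  have up : ∀ g ∈ F1, g ≠ f.erase p ∪ Ico N (N + 1) → g ∈ F5 := by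
    intro g hg hne
    have g2 := p2 g hg hne
    have g3 := p3 g g2 (by
      by_cases hq : q = 0
      · subst hq
        have hfe : f.erase p = {x, y} := by
          symm
          apply eq_of_subset_of_card_le
          · intro z hz; simp at hz
            rcases hz with rfl | rfl
            · exact mem_erase.mpr ⟨hpx.symm, hx⟩
            · exact mem_erase.mpr ⟨hpy.symm, hy⟩
          · rw [card_pair hxy, card_erase_of_mem hp]; omega
        rw [← hfe]; exact hne
      · exact sp_ne s1 hg (v := N + 1) (by simp; omega) le_rfl)
    have g4 := p4 g g3 (sp_ne s1 hg (v := N + 1) (by simp) le_rfl)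
    exact p5 g g4 (sp_ne s1 hg (v := N + 1) (by simp; omega) le_rfl)
  have e5 : N + 1 + q + 1 + 1 + 1 = N + (q + 4) := by omega
  rw [e5] at s5
  refine ⟨F5, s5, ?_, ?_, ?_⟩
  · intro g hg hne
    exact up g (p1 g hg hne) (sp_ne h hg (v := N) (by simp) le_rfl)
  · rintro g (⟨w, hw1, hw2, rfl⟩ | rfl | rfl)
    · have := q5 w (by simp; omega)
      convert this using 1
      ext z; simp only [mem_insert, mem_Ico, mem_erase]; omega
    · refine p5 _ k4 (fun e => ?_)
      have : x ∈ Ico N (N + q + 3) := e ▸ mem_insert_self _ _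
      simp at this; omega
    · refine p5 _ (p4 _ k3 (fun e => ?_)) (fun e => ?_)
      · have : y ∈ insert x (Ico N (N + q + 2)) := e ▸ mem_insert_self _ _
        simp at this; omega
      · have : y ∈ Ico N (N + q + 3) := e ▸ mem_insert_self _ _
        simp at this; omega
  · intro w hw hwp
    refine up _ (q1 w hw) (fun e => ?_)
    have : p ∈ insert N (f.erase w) := mem_insert_of_mem (mem_erase.mpr ⟨hwp.symm, hp⟩)
    rw [e] at this
    have hpN : p < N := by simpa using hfN hp
    simp at this; omega

theorem arm_count {n c x y : ℕ} (hn : 4 ≤ n) {T : Finset ℕ}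
    (hT : IsTransversal T (ArmFacets n c x y)) :
    2 ≤ (T ∩ Ico c (c + n)).card ∨ (1 ≤ (T ∩ Ico c (c + n)).card ∧ x ∈ T ∧ y ∈ T) := by
  by_cases h2 : 2 ≤ (T ∩ Ico c (c + n)).card
  · exact Or.inl h2
  right
  obtain ⟨t, ht⟩ := hT _ (Or.inl ⟨c, le_rfl, by omega, rfl⟩)
  simp only [mem_inter, mem_erase, mem_Ico] at ht
  have huniq : ∀ z ∈ T, c ≤ z → z < c + n → z = t := by
    intro z hz h1 h3
    have hle : (T ∩ Ico c (c + n)).card ≤ 1 := by omega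
    exact card_le_one.mp hle z (by simp [*]) t (by simp; tauto)
  have htl : t + 1 = c + n := by
    by_contra hne
    obtain ⟨z, hz⟩ := hT _ (Or.inl ⟨t, by omega, by omega, rfl⟩)
    simp only [mem_inter, mem_erase, mem_Ico] at hz
    exact hz.2.1 (huniq z hz.1 hz.2.2.1 hz.2.2.2)
  refine ⟨card_pos.mpr ⟨t, by simp; tauto⟩, ?_, ?_⟩
  · obtain ⟨z, hz⟩ := hT _ (Or.inr (Or.inl rfl))
    simp only [mem_inter, mem_insert, mem_Ico] at hz
    rcases hz.2 with e | e
    · exact e ▸ hz.1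
    · have := huniq z hz.1 (by omega) (by omega); omega
  · obtain ⟨z, hz⟩ := hT _ (Or.inr (Or.inr rfl))
    simp only [mem_inter, mem_insert, mem_Ico] at hz
    rcases hz.2 with e | e
    · exact e ▸ hz.1
    · have := huniq z hz.1 (by omega) (by omega); omega

def BlockFacets (n b : ℕ) : Set (Finset ℕ) :=
  {f | f = (Ico b (b + n)).erase (b + 1) ∨
    ∃ r, r + 1 < n ∧ f ∈ ArmFacets n (b + n + r * n) (b + (n - 1 - r)) (b + (n - 2 - r))}

theorem block_count {n b : ℕ} (hn : 4 ≤ n) {T : Finset ℕ}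
    (hT : IsTransversal T (BlockFacets n b)) :
    2 * n - 1 ≤ (T ∩ Ico b (b + n ^ 2)).card := by
  set S := T ∩ Ico b (b + n) with hS
  set P : ℕ → Prop := fun i => b + (n - 1 - i) ∈ T ∧ b + (n - 2 - i) ∈ T with hP
  have key : ∀ r, r < n → S.card + 2 * r ≤
      (T ∩ Ico b (b + n + r * n)).card + ((range r).filter P).card := by
    intro r
    induction r with
    | zero => intro _; simp [hS]
    | succ r ih =>
      intro hr
      have ih := ih (by omega)
      have hs : T ∩ Ico b (b + n + (r + 1) * n) =
          (T ∩ Ico b (b + n + r * n)) ∪ (T ∩ Ico (b + n + r * n) (b + n + r * n + n)) := by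
        rw [← inter_union_distrib_left, Ico_union_Ico_eq_Ico (by nlinarith) (by omega)]
        congr 2; ring
      have hd : Disjoint (T ∩ Ico b (b + n + r * n))
          (T ∩ Ico (b + n + r * n) (b + n + r * n + n)) := by
        rw [disjoint_left]; intro z; simp only [mem_inter, mem_Ico]; omega
      rw [hs, card_union_of_disjoint hd, range_add_one, filter_insert]
      have ha := arm_count hn (T := T) (c := b + n + r * n) (x := b + (n - 1 - r))
        (y := b + (n - 2 - r)) (fun e he => hT e (Or.inr ⟨r, hr, he⟩))
      by_cases hPr : P r
      · rw [if_pos hPr, card_insert_of_notMem (by simp)]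
        rcases ha with ha | ha <;> omega
      · rw [if_neg hPr]
        rcases ha with ha | ha
        · omega
        · exact absurd ha.2 hPr
  have hk := key (n - 1) (by omega)
  have hne : S.Nonempty := by
    obtain ⟨z, hz⟩ := hT _ (Or.inl rfl)
    refine ⟨z, ?_⟩
    simp only [mem_inter, mem_erase] at hz
    rw [hS, mem_inter]; exact ⟨hz.1, hz.2.2⟩
  have hc : ((range (n - 1)).filter P).card ≤ (S.erase (S.min' hne)).card := by
    apply card_le_card_of_injOn (fun i => b + (n - 1 - i))
    · intro i hi
      simp only [coe_filter, mem_range, Set.mem_ofPred_eq, hP] at hi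
      have h2 : b + (n - 2 - i) ∈ S := by
        rw [hS, mem_inter, mem_Ico]; exact ⟨hi.2.2, by omega, by omega⟩
      have h3 := S.min'_le _ h2
      show b + (n - 1 - i) ∈ S.erase _
      rw [mem_erase]
      refine ⟨?_, mem_inter.mpr ⟨hi.2.1, mem_Ico.mpr ⟨by omega, by omega⟩⟩⟩
      omega
    · intro i hi j hj hij
      simp only [coe_filter, mem_range, Set.mem_ofPred_eq] at hi hj hij
      omega
  rw [card_erase_of_mem (S.min'_mem hne)] at hc
  have hSp := card_pos.mpr hne
  have he : b + n + (n - 1) * n = b + n ^ 2 := by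
    obtain ⟨q, rfl⟩ : ∃ q, n = q + 1 := ⟨n - 1, by omega⟩
    simp; ring
  rw [he] at hk
  omega

theorem sp_many {n N : ℕ} (hn : 4 ≤ n) {F : Set (Finset ℕ)} (h : Sp n N F) (t : ℕ)
    (φ : ℕ → Finset ℕ) (x y : ℕ → ℕ) (hφ : ∀ i < t, φ i ∈ F)
    (hinj : ∀ i < t, ∀ j < t, φ i = φ j → i = j)
    (hx : ∀ i < t, x i ∈ φ i) (hy : ∀ i < t, y i ∈ φ i) (hxy : ∀ i < t, x i ≠ y i) :
    ∃ F', Sp n (N + t * n) F' ∧ (∀ g ∈ F, (∀ i < t, g ≠ φ i) → g ∈ F') ∧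
      ∀ i < t, ArmFacets n (N + i * n) (x i) (y i) ⊆ F' := by
  induction t with
  | zero => exact ⟨F, by simpa using h, fun g hg _ => hg, fun i hi => by omega⟩
  | succ t ih =>
    obtain ⟨F1, s1, p1, a1⟩ := ih (fun i hi => hφ i (by omega))
      (fun i hi j hj => hinj i (by omega) j (by omega))
      (fun i hi => hx i (by omega)) (fun i hi => hy i (by omega)) (fun i hi => hxy i (by omega))
    have hm : φ t ∈ F1 := p1 _ (hφ t (by omega)) (fun i hi e => by
      have := hinj t (by omega) i (by omega) e; omega)
    obtain ⟨p, hp, hpn⟩ : ∃ p ∈ φ t, p ∉ ({x t, y t} : Finset ℕ) := by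
      apply exists_mem_notMem_of_card_lt_card
      have := sp_card h _ (hφ t (by omega))
      have := card_le_two (a := x t) (b := y t)
      omega
    simp only [mem_insert, mem_singleton, not_or] at hpn
    obtain ⟨F2, s2, p2, a2, -⟩ := sp_arm hn s1 hm (x t) (y t) p (hx t (by omega)) (hy t (by omega))
      hp (hxy t (by omega)) hpn.1 hpn.2
    have e : N + t * n + n = N + (t + 1) * n := by ring
    rw [e] at s2
    refine ⟨F2, s2, ?_, ?_⟩
    · intro g hg hne
      exact p2 g (p1 g hg (fun i hi => hne i (by omega))) (hne t (by omega))
    · intro i hi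
      rcases Nat.lt_succ_iff_lt_or_eq.mp hi with hi | rfl
      · intro g hg
        refine p2 g (a1 i hi hg) ?_
        rintro rfl
        have hsub := sp_sub h _ (hφ t (by omega))
        have : N + i * n + 1 ∈ φ t := by
          rcases hg with ⟨w, h1, h2, e⟩ | e | e
          · by_cases hw : w = N + i * n + 1
            · exfalso
              have h3 : N + i * n ∈ φ t := by rw [e]; simp; omega
              have := hsub h3
              simp at this
            · rw [e]; simp; omega
          · rw [e]; simp; omega
          · rw [e]; simp; omega
        have := hsub this
        simp at this
        omega
      · exact a2

theorem arm_small {n c x y : ℕ} {f : Finset ℕ} (hf : f ∈ ArmFacets n c x y) {u v : ℕ}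
    (hu : u ∈ f) (hv : v ∈ f) (huc : u < c) (hvc : v < c) : u = v := by
  rcases hf with ⟨w, _, _, rfl⟩ | rfl | rfl
  · simp at hu; omega
  · simp at hu hv; omega
  · simp at hu hv; omega

theorem sp_block {n b : ℕ} (hn : 4 ≤ n) {F : Set (Finset ℕ)} (h : Sp n (b + n) F)
    (hE : ∀ w, b ≤ w → w + 1 < b + n → (Ico b (b + n)).erase w ∈ F) :
    ∃ F' g, Sp n (b + n ^ 2) F' ∧ g ∈ F' ∧ g ∉ BlockFacets n b ∧ ¬ g ⊆ range b ∧
      (∀ f ∈ F, f ⊆ range b → f ∈ F') ∧ BlockFacets n b ⊆ F' := by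
  obtain ⟨F1, s1, p1, a1, q1⟩ := sp_arm hn h (hE b le_rfl (by omega)) (b + (n - 1 - 0))
    (b + (n - 2 - 0)) (b + 1) (by simp; omega) (by simp; omega) (by simp; omega) (by omega)
    (by omega) (by omega)
  set f0 := (Ico b (b + n)).erase b with hf0
  have hf0m : ∀ z, z ∈ f0 ↔ (z ≠ b ∧ b ≤ z ∧ z < b + n) := fun z => by
    rw [hf0, mem_erase, mem_Ico]
  have hsp := q1 (b + (n - 1)) ((hf0m _).mpr (by omega)) (by omega)
  have hg := q1 (b + 2) ((hf0m _).mpr (by omega)) (by omega)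
  set sp := insert (b + n) (f0.erase (b + (n - 1))) with hspd
  set g := insert (b + n) (f0.erase (b + 2)) with hgd
  have hspm : ∀ z, z ∈ sp ↔ (z = b + n ∨ (z ≠ b + (n - 1) ∧ z ≠ b ∧ b ≤ z ∧ z < b + n)) :=
    fun z => by rw [hspd, mem_insert, mem_erase, hf0m]
  have hgm : ∀ z, z ∈ g ↔ (z = b + n ∨ (z ≠ b + 2 ∧ z ≠ b ∧ b ≤ z ∧ z < b + n)) :=
    fun z => by rw [hgd, mem_insert, mem_erase, hf0m]
  clear_value f0 sp g
  set φ : ℕ → Finset ℕ := fun i => if i = 0 then sp else (Ico b (b + n)).erase (b + (n - 1 - i))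
    with hφ
  have hφ0 : φ 0 = sp := by simp [hφ]
  have hφ1 : ∀ i, i ≠ 0 → φ i = (Ico b (b + n)).erase (b + (n - 1 - i)) := fun i hi => by
    simp [hφ, hi]
  clear_value φ
  have hEm : ∀ w z, z ∈ (Ico b (b + n)).erase w ↔ (z ≠ w ∧ b ≤ z ∧ z < b + n) := fun w z => by
    rw [mem_erase, mem_Ico]
  have hspE : ∀ w, sp ≠ (Ico b (b + n)).erase w := fun w e => by
    have : b + n ∈ sp := (hspm _).mpr (Or.inl rfl)
    rw [e, hEm] at this; omega
  have hgE : ∀ w, g ≠ (Ico b (b + n)).erase w := fun w e => by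
    have : b + n ∈ g := (hgm _).mpr (Or.inl rfl)
    rw [e, hEm] at this; omega
  have hEE : ∀ w w', b ≤ w → w < b + n → (Ico b (b + n)).erase w = (Ico b (b + n)).erase w' →
      w = w' := by
    intro w w' h1 h2 e
    by_contra hne
    have : w ∈ (Ico b (b + n)).erase w' := (hEm _ _).mpr ⟨hne, h1, h2⟩
    rw [← e, hEm] at this
    exact this.1 rfl
  have hX : ∀ i < n - 2, b + (n - 1 - (i + 1)) ∈ φ i := by
    intro i hi
    by_cases h0 : i = 0
    · subst h0; rw [hφ0, hspm]; omega
    · rw [hφ1 i h0, hEm]; omega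
  have hY : ∀ i < n - 2, b + (n - 2 - (i + 1)) ∈ φ i := by
    intro i hi
    by_cases h0 : i = 0
    · subst h0; rw [hφ0, hspm]; omega
    · rw [hφ1 i h0, hEm]; omega
  obtain ⟨F2, s2, p2, a2⟩ := sp_many hn s1 (n - 2) φ (fun i => b + (n - 1 - (i + 1)))
    (fun i => b + (n - 2 - (i + 1)))
    (by
      intro i hi
      by_cases h0 : i = 0
      · subst h0; rw [hφ0]; exact hsp
      · rw [hφ1 i h0]
        refine p1 _ (hE _ (by omega) (by omega)) (fun e => ?_)
        rw [hf0] at e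
        have := hEE _ _ (by omega) (by omega) e
        omega)
    (by
      intro i hi j hj e
      by_cases h0 : i = 0
      · by_cases h1 : j = 0
        · omega
        · rw [h0, hφ0, hφ1 j h1] at e
          exact absurd e (hspE _)
      · by_cases h1 : j = 0
        · rw [h1, hφ0, hφ1 i h0] at e
          exact absurd e.symm (hspE _)
        · rw [hφ1 i h0, hφ1 j h1] at e
          have := hEE _ _ (by omega) (by omega) e
          omega)
    hX hY (fun i hi => by omega)
  have e2 : b + n + n + (n - 2) * n = b + n ^ 2 := by
    obtain ⟨q, rfl⟩ : ∃ q, n = q + 2 := ⟨n - 2, by omega⟩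
    simp; ring
  rw [e2] at s2
  refine ⟨F2, g, s2, p2 g hg ?_, ?_, ?_, ?_, ?_⟩
  · intro i hi e
    by_cases h0 : i = 0
    · rw [h0, hφ0] at e
      have : b + (n - 1) ∈ g := (hgm _).mpr (by omega)
      rw [e, hspm] at this; omega
    · rw [hφ1 i h0] at e
      exact hgE _ e
  · rintro (e | ⟨r, hr, e⟩)
    · exact hgE _ e
    · have := arm_small e (u := b + 1) (v := b + (n - 1)) ((hgm _).mpr (by omega))
        ((hgm _).mpr (by omega)) (by omega) (by omega)
      omega
  · intro e
    have := e ((hgm (b + n)).mpr (Or.inl rfl))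
    simp at this
  · intro f hf hfb
    refine p2 f (p1 f hf ?_) ?_
    · rintro rfl
      have := hfb ((hf0m (b + 1)).mpr (by omega))
      simp at this
    · rintro i hi rfl
      have := hfb (hX i hi)
      simp at this
  · rintro f (rfl | ⟨r, hr, hf⟩)
    · refine p2 _ (p1 _ (hE _ (by omega) (by omega)) ?_) ?_
      · intro e
        rw [hf0] at e
        have := hEE _ _ (by omega) (by omega) e
        omega
      · intro i hi e
        by_cases h0 : i = 0
        · rw [h0, hφ0] at e
          exact hspE _ e.symm
        · rw [hφ1 i h0] at e
          have := hEE _ _ (by omega) (by omega) e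
          omega
    · by_cases h0 : r = 0
      · subst h0
        rw [Nat.zero_mul, Nat.add_zero] at hf
        refine p2 f (a1 hf) ?_
        rintro i hi rfl
        have := arm_small hf (hX i hi) (hY i hi) (by omega) (by omega)
        omega
      · obtain ⟨i, rfl⟩ : ∃ i, r = i + 1 := ⟨r - 1, by omega⟩
        apply a2 i (by omega)
        have e : b + n + n + i * n = b + n + (i + 1) * n := by ring
        rw [e]
        exact hf

def HH (n k : ℕ) : Prop :=
    ∃ F, Sp n (n ^ 2 * k + n) F ∧
      (∀ w, n ^ 2 * k ≤ w → w + 1 < n ^ 2 * k + n →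
        (Ico (n ^ 2 * k) (n ^ 2 * k + n)).erase w ∈ F) ∧
      ∀ T, IsTransversal T {f | f ∈ F ∧ f ⊆ range (n ^ 2 * k)} →
        (2 * n - 1) * k ≤ (T ∩ range (n ^ 2 * k)).card

def MM (n k : ℕ) : Prop :=
    ∃ F, ∃ g ∈ F, Sp n (n ^ 2 * k) F ∧
      ∀ T, IsTransversal T {f | f ∈ F ∧ f ≠ g} →
        (2 * n - 1) * k ≤ (T ∩ range (n ^ 2 * k)).card

theorem hh_mm {n : ℕ} (hn : 4 ≤ n) (k : ℕ) (h : HH n k) : MM n (k + 1) := by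
  obtain ⟨F, s, hE, hT⟩ := h
  obtain ⟨F', g, s', hg, hgB, hgr, hold, hB⟩ := sp_block hn s hE
  have e : n ^ 2 * k + n ^ 2 = n ^ 2 * (k + 1) := by ring
  refine ⟨F', g, hg, e ▸ s', fun T hTr => ?_⟩
  have h1 := hT T (fun f hf => hTr f ⟨hold f hf.1 hf.2, by rintro rfl; exact hgr hf.2⟩)
  have h2 := block_count hn (T := T) (b := n ^ 2 * k)
    (fun f hf => hTr f ⟨hB hf, by rintro rfl; exact hgB hf⟩)
  have hs : T ∩ range (n ^ 2 * (k + 1)) =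
      (T ∩ range (n ^ 2 * k)) ∪ (T ∩ Ico (n ^ 2 * k) (n ^ 2 * k + n ^ 2)) := by
    rw [← e]
    ext z; simp only [mem_inter, mem_union, mem_range, mem_Ico]
    by_cases hz : z ∈ T
    · simp only [hz, true_and]; omega
    · simp [hz]
  have hd : Disjoint (T ∩ range (n ^ 2 * k)) (T ∩ Ico (n ^ 2 * k) (n ^ 2 * k + n ^ 2)) := by
    rw [disjoint_left]; intro z; simp only [mem_inter, mem_Ico, mem_range]; omega
  rw [hs, card_union_of_disjoint hd, Nat.mul_succ]
  omega

theorem mm_hh {n : ℕ} (hn : 4 ≤ n) (k : ℕ) (h : MM n k) : HH n k := by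
  obtain ⟨F, g, hg, s, hT⟩ := h
  have hc := sp_card s g hg
  obtain ⟨x, hx, y, hy, p, hp, hxy, hxp, hyp⟩ := two_lt_card.mp (show 2 < g.card by omega)
  obtain ⟨F1, s1, p1, a1, -⟩ := sp_arm hn s hg x y p hx hy hp hxy hxp.symm hyp.symm
  refine ⟨F1, s1, fun w h1 h2 => a1 (Or.inl ⟨w, h1, h2, rfl⟩), fun T hTr => ?_⟩
  exact hT T (fun f hf => hTr f ⟨p1 f hf.1 hf.2, sp_sub s f hf.1⟩)

theorem hh_all {n : ℕ} (hn : 4 ≤ n) (k : ℕ) : HH n k := by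
  induction k with
  | zero =>
    refine ⟨{f | ∃ w < n, f = (range n).erase w}, by simpa using Sp.base, ?_, fun T _ => by simp⟩
    intro w _ hw
    refine ⟨w, by omega, ?_⟩
    ext z; simp
  | succ k ih => exact mm_hh hn _ (hh_mm hn k ih)

/-- **Theorem (Lower bound, general case).** For all integers `d ≥ 2` and `k ≥ 1`,
there exists a stacked `d`-sphere `S` on `(d+2)²k` vertices with `τ(S) ≥ (2d+3)k`. -/
theorem stacked_sphere_lower_bound (d k : ℕ) (hd : 2 ≤ d) (hk : 1 ≤ k) :
    ∃ (m : ℕ) (σ : Fin m → Finset ℕ),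
      IsStackedBall d m σ ∧
      (vertexSet m σ).card = (d + 2) ^ 2 * k ∧
      (2 * d + 3) * k ≤ tau (sphereFacets d m σ) := by
  obtain ⟨q, rfl⟩ : ∃ q, k = q + 1 := ⟨k - 1, by omega⟩
  obtain ⟨F, g, -, s, hT⟩ := hh_mm (n := d + 2) (by omega) q (hh_all (by omega) q)
  obtain ⟨m, σ, hB, hV, hF⟩ := sp_final d _ F s
  refine ⟨m, σ, hB, by rw [hV, card_range], ?_⟩
  have hne : {n | ∃ T : Finset ℕ, T.card = n ∧ IsTransversal T (sphereFacets d m σ)}.Nonempty := by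
    refine ⟨_, vertexSet m σ, rfl, ?_⟩
    rintro f ⟨hc, i, hi, -⟩
    obtain ⟨z, hz⟩ := card_pos.mp (show 0 < f.card by omega)
    exact ⟨z, mem_inter.mpr ⟨mem_biUnion.mpr ⟨i, mem_univ _, hi hz⟩, hz⟩⟩
  obtain ⟨T, hTc, hTt⟩ := Nat.sInf_mem hne
  have h1 := hT T (fun f hf => hTt f (hF hf.1))
  have h2 := card_le_card (inter_subset_left (s₁ := T) (s₂ := range ((d + 2) ^ 2 * (q + 1))))
  have e : 2 * (d + 2) - 1 = 2 * d + 3 := by omega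
  rw [e] at h1
  show _ ≤ sInf _
  rw [← hTc]
  exact h1.trans h2
end

section
/- Let S be a stacked 2-sphere on {1,2,…,10} with S = ∂(σ₁,…,σ₇), where each σ_i = {α_i, β_i, γ_i, i+3} with α_i, β_i, γ_i < i+3 (so the dual graph is a path in this order and the vertices are labeled in order of appearance). Then for every 2-element subset L ⊆ {1,2,3}, there exist transversals T₁ and T₂ of S, each of size at most 4, such that T₁ ∩ L ≠ ∅, T₂ ∩ L ≠ ∅, and |σ₇ ∩ (T₁ ∪ T₂)| ≥ 3. -/
open Finset

namespace KeyTen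

def hit (T x y z : ℕ) : Bool := T.testBit x || (T.testBit y || T.testBit z)

def filt {α : Type} (p : ℕ → Bool) : List ℕ → List ℕ → (List ℕ → α) → α
  | [], acc, k => k acc
  | x :: xs, acc, k => bif p x then filt p xs (x :: acc) k else filt p xs acc k

def three (a b c n U : ℕ) : Bool :=
  (U.testBit n && ((U.testBit a && (U.testBit b || U.testBit c)) ||
    (U.testBit b && U.testBit c))) || (U.testBit a && (U.testBit b && U.testBit c))

def fin0 (a b c n : ℕ) (Ts : List ℕ) : Bool :=
  Ts.any fun X => Ts.any fun Y => three a b c n (X ||| Y)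

def check : ℕ → ℕ → ℕ → ℕ → List ℕ → Bool
  | 0, a, b, c, Ts =>
    filt (fun T => hit T a b 10 && (hit T a c 10 && hit T b c 10)) Ts [] fun Ts => fin0 a b c 10 Ts
  | k + 1, a, b, c, Ts =>
    filt (fun T => hit T a b (9 - k) && hit T a c (9 - k)) Ts [] (fun Ts => check k b c (9 - k) Ts)
    && (filt (fun T => hit T b a (9 - k) && hit T b c (9 - k)) Ts []
      (fun Ts => check k a c (9 - k) Ts)
    && filt (fun T => hit T c a (9 - k) && hit T c b (9 - k)) Ts []
      (fun Ts => check k a b (9 - k) Ts))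

def root : List ℕ := [
  30, 46, 54, 58, 60, 78, 86, 90, 92, 102, 106, 108, 114, 116, 120, 142, 150, 154, 156, 166, 170,
  172, 178, 180, 184, 198, 202, 204, 210, 212, 216, 226, 228, 232, 240, 270, 278, 282, 284, 294,
  298, 300, 306, 308, 312, 326, 330, 332, 338, 340, 344, 354, 356, 360, 368, 390, 394, 396, 402,
  404, 408, 418, 420, 424, 432, 450, 452, 456, 464, 480, 526, 534, 538, 540, 550, 554, 556, 562,
  564, 568, 582, 586, 588, 594, 596, 600, 610, 612, 616, 624, 646, 650, 652, 658, 660, 664, 674,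
  676, 680, 688, 706, 708, 712, 720, 736, 774, 778, 780, 786, 788, 792, 802, 804, 808, 816, 834,
  836, 840, 848, 864, 898, 900, 904, 912, 928, 960, 1038, 1046, 1050, 1052, 1062, 1066, 1068,
  1074, 1076, 1080, 1094, 1098, 1100, 1106, 1108, 1112, 1122, 1124, 1128, 1136, 1158, 1162, 1164,
  1170, 1172, 1176, 1186, 1188, 1192, 1200, 1218, 1220, 1224, 1232, 1248, 1286, 1290, 1292, 1298,
  1300, 1304, 1314, 1316, 1320, 1328, 1346, 1348, 1352, 1360, 1376, 1410, 1412, 1416, 1424, 1440,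
  1472, 1542, 1546, 1548, 1554, 1556, 1560, 1570, 1572, 1576, 1584, 1602, 1604, 1608, 1616, 1632,
  1666, 1668, 1672, 1680, 1696, 1728, 1794, 1796, 1800, 1808, 1824, 1856, 1920]

def start (p q d a b c : ℕ) : Bool :=
  filt (fun T => hit T p q q && (hit T a b d && (hit T a c d && hit T b c d))) root []
    fun Ts => check 5 a b c Ts

def startAll (p q : ℕ) : Bool :=
  start p q 1 2 3 4 && (start p q 2 1 3 4 && (start p q 3 1 2 4 && start p q 4 1 2 3))

set_option maxRecDepth 100000 in
theorem start12 : startAll 1 2 = true := by decide +kernel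
set_option maxRecDepth 100000 in
theorem start13 : startAll 1 3 = true := by decide +kernel
set_option maxRecDepth 100000 in
theorem start23 : startAll 2 3 = true := by decide +kernel

def toF (T : ℕ) : Finset ℕ := (Finset.range 11).filter fun x => T.testBit x = true

set_option maxRecDepth 100000 in
theorem root_card : ∀ T ∈ root, (toF T).card ≤ 4 := by decide +kernel

end KeyTen

namespace KeyTen

theorem filt_spec {α : Type} (p : ℕ → Bool) (l : List ℕ) (acc : List ℕ) (k : List ℕ → α) :
    filt p l acc k = k ((l.filter p).reverse ++ acc) := by
  induction l generalizing acc with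
  | nil => simp [filt]
  | cons x xs ih =>
    cases h : p x <;> simp [filt, h, ih]

theorem mem_toF (T x : ℕ) : x ∈ toF T ↔ x ≤ 10 ∧ T.testBit x = true := by
  simp [toF]; omega

theorem hit_spec {T x y z : ℕ} (h : hit T x y z = true) (hx : x ≤ 10) (hy : y ≤ 10) (hz : z ≤ 10) :
    (toF T ∩ {x, y, z}).Nonempty := by
  simp only [hit, Bool.or_eq_true] at h
  rcases h with h | h | h
  · exact ⟨x, by simp [mem_toF, *]⟩
  · exact ⟨y, by simp [mem_toF, *]⟩
  · exact ⟨z, by simp [mem_toF, *]⟩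

theorem three_sub {a b c n : ℕ} {f : Finset ℕ} (hf : f.card = 3)
    (hs : f ⊆ {a, b, c, n}) (hc : ({a, b, c, n} : Finset ℕ).card = 4) :
    f = {b, c, n} ∨ f = {a, c, n} ∨ f = {a, b, n} ∨ f = {a, b, c} := by
  have h1 : (({a, b, c, n} : Finset ℕ) \ f).card = 1 := by
    rw [Finset.card_sdiff_of_subset hs, hc, hf]
  obtain ⟨x, hx⟩ := Finset.card_eq_one.1 h1
  have hx' : x ∈ ({a, b, c, n} : Finset ℕ) ∧ x ∉ f := by
    rw [← Finset.mem_sdiff, hx]; simp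
  have key : ∀ g : Finset ℕ, f ⊆ g → g.card ≤ 3 → f = g := fun g h h' =>
    Finset.eq_of_subset_of_card_le h (by omega)
  have hm : ∀ y ∈ f, y ≠ x ∧ (y = a ∨ y = b ∨ y = c ∨ y = n) := fun y hy =>
    ⟨fun h => hx'.2 (h ▸ hy), by simpa using hs hy⟩
  have hx1 := hx'.1
  simp only [Finset.mem_insert, Finset.mem_singleton] at hx1
  rcases hx1 with rfl | rfl | rfl | rfl
  · left; exact key _ (fun y hy => by have := hm y hy; simp; tauto) Finset.card_le_three
  · right; left; exact key _ (fun y hy => by have := hm y hy; simp; tauto) Finset.card_le_three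
  · right; right; left
    exact key _ (fun y hy => by have := hm y hy; simp; tauto) Finset.card_le_three
  · right; right; right
    exact key _ (fun y hy => by have := hm y hy; simp; tauto) Finset.card_le_three

theorem card4 {a b c n : ℕ} (hc : ({a, b, c, n} : Finset ℕ).card = 4) :
    a ≠ b ∧ a ≠ c ∧ a ≠ n ∧ b ≠ c ∧ b ≠ n ∧ c ≠ n := by
  have key : ∀ x y z : ℕ, ¬ (({a, b, c, n} : Finset ℕ) ⊆ {x, y, z}) := by
    intro x y z h
    have h1 := Finset.card_le_card h
    have h2 : ({x, y, z} : Finset ℕ).card ≤ 3 := Finset.card_le_three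
    omega
  refine ⟨fun h => key b c n ?_, fun h => key b c n ?_, fun h => key b c n ?_,
    fun h => key a c n ?_, fun h => key a c n ?_, fun h => key a b n ?_⟩ <;>
  · intro x hx
    simp only [Finset.mem_insert, Finset.mem_singleton] at hx ⊢
    omega

/-- next simplex from intersection -/
theorem next {s t : Finset ℕ} {n : ℕ} (ht : t.card = 4) (hn : n ∈ t) (hns : n ∉ s)
    (hc : (s ∩ t).card = 3) : t = insert n (s ∩ t) := by
  symm
  apply Finset.eq_of_subset_of_card_le
  · intro x hx
    rcases Finset.mem_insert.1 hx with rfl | hx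
    · exact hn
    · exact (Finset.mem_inter.1 hx).2
  · rw [Finset.card_insert_of_notMem (fun h => hns (Finset.mem_inter.1 h).1)]; omega

def Inv (σ : Fin 7 → Finset ℕ) (p q : ℕ) (i : Fin 7) (k : ℕ) : Prop :=
  ∃ a b c : ℕ, ∃ Ts : List ℕ, σ i = {a, b, c, 10 - k} ∧
    (∃ j : Fin 7, j.val + 1 = i.val ∧ {a, b, c} ⊆ σ j) ∧
    check k a b c Ts = true ∧
    ∀ T ∈ Ts, T ∈ root ∧ hit T p q q = true ∧ ∀ f ∈ sphereFacets 2 7 σ,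
      (∃ j : Fin 7, j.val < i.val ∧ f ⊆ σ j) → (toF T ∩ f).Nonempty

theorem notTwo {σ : Fin 7 → Finset ℕ} {f : Finset ℕ} (hf : f ∈ sphereFacets 2 7 σ)
    {i j : Fin 7} (hi : f ⊆ σ i) (hj : f ⊆ σ j) : i = j := by
  obtain ⟨_, x, _, hx⟩ := hf
  rw [hx i hi, hx j hj]

section
variable {σ : Fin 7 → Finset ℕ} (h4 : ∀ i, (σ i).card = 4) (hP : IsPathOrder 2 7 σ)
  (hle : ∀ i, ∀ x ∈ σ i, 1 ≤ x ∧ x ≤ i.val + 4) (hmem : ∀ i, i.val + 4 ∈ σ i)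
include h4 hP hle hmem

theorem next_idx (i j : Fin 7) (hij : i.val + 1 = j.val) :
    (σ i ∩ σ j).card = 3 ∧ σ j = insert (j.val + 4) (σ i ∩ σ j) := by
  have h := ((hP i j).2 (Or.inl hij)).2
  refine ⟨h, next (h4 j) (hmem j) (fun h => ?_) h⟩
  have := hle i _ h
  omega

/-- one step, for a particular choice -/
theorem step_aux (p q : ℕ) (i j : Fin 7) (k : ℕ) (hij : i.val + 1 = j.val) (hk : i.val + (k + 1) = 6)
    (a b c : ℕ) (Ts : List ℕ) (hs : σ i = {a, b, c, 9 - k}) (l : Fin 7) (hl : l.val + 1 = i.val)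
    (hsub : {a, b, c} ⊆ σ l) (hI : σ i ∩ σ j = {b, c, 9 - k})
    (hck : filt (fun T => hit T a b (9 - k) && hit T a c (9 - k)) Ts []
      (fun Ts => check k b c (9 - k) Ts) = true)
    (hT : ∀ T ∈ Ts, T ∈ root ∧ hit T p q q = true ∧ ∀ f ∈ sphereFacets 2 7 σ,
      (∃ j : Fin 7, j.val < i.val ∧ f ⊆ σ j) → (toF T ∩ f).Nonempty) :
    Inv σ p q j k := by
  rw [filt_spec] at hck
  have hj := (next_idx h4 hP hle hmem i j hij).2
  rw [hI] at hj
  have hbd : ∀ x ∈ σ i, x ≤ 10 := fun x hx => by have := hle i x hx; omega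
  rw [hs] at hbd
  simp only [Finset.mem_insert, Finset.mem_singleton, forall_eq_or_imp, forall_eq] at hbd
  obtain ⟨ha, hb, hc, hn⟩ := hbd
  refine ⟨b, c, 9 - k, _, ?_, ⟨i, hij, ?_⟩, hck, ?_⟩
  · rw [hj]
    have : j.val + 4 = 10 - k := by omega
    rw [this]; ext x; simp; tauto
  · rw [← hI]; exact Finset.inter_subset_left
  · intro T hTm
    simp only [List.append_nil, List.mem_reverse, List.mem_filter, Bool.and_eq_true] at hTm
    obtain ⟨hTm, h1, h2⟩ := hTm
    obtain ⟨r1, r2, r3⟩ := hT T hTm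
    refine ⟨r1, r2, ?_⟩
    rintro f hf ⟨m, hm, hfm⟩
    by_cases hmi : m.val < i.val
    · exact r3 f hf ⟨m, hmi, hfm⟩
    have : m = i := Fin.ext (by omega)
    subst this
    have h4i := h4 m
    have hfm' := hfm
    rw [hs] at h4i hfm'
    rcases three_sub hf.1 hfm' h4i with h | h | h | h
    · exfalso
      have : m = j := notTwo hf hfm (by rw [h, ← hI]; exact Finset.inter_subset_right)
      rw [this] at hij; omega
    · rw [h]; exact hit_spec h2 ha hc hn
    · rw [h]; exact hit_spec h1 ha hb hn
    · exfalso
      have : m = l := notTwo hf hfm (by rw [h]; exact hsub)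
      rw [this] at hl; omega

theorem step (p q : ℕ) (i j : Fin 7) (k : ℕ) (hij : i.val + 1 = j.val) (hk : i.val + (k + 1) = 6)
    (h : Inv σ p q i (k + 1)) : Inv σ p q j k := by
  obtain ⟨a, b, c, Ts, hs, ⟨l, hl, hsub⟩, hck, hT⟩ := h
  have e : 10 - (k + 1) = 9 - k := by omega
  rw [e] at hs
  rw [check] at hck
  simp only [Bool.and_eq_true] at hck
  obtain ⟨c1, c2, c3⟩ := hck
  have h4i := h4 i
  rw [hs] at h4i
  have hsub' : σ i ∩ σ j ⊆ {a, b, c, 9 - k} := by rw [← hs]; exact Finset.inter_subset_left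
  rcases three_sub (next_idx h4 hP hle hmem i j hij).1 hsub' h4i with h | h | h | h
  · exact step_aux h4 hP hle hmem p q i j k hij hk a b c Ts hs l hl hsub h c1 hT
  · refine step_aux h4 hP hle hmem p q i j k hij hk b a c Ts ?_ l hl ?_ h c2 hT
    · rw [hs]; ext x; simp; tauto
    · rw [← show ({a, b, c} : Finset ℕ) = {b, a, c} by ext x; simp; tauto]; exact hsub
  · refine step_aux h4 hP hle hmem p q i j k hij hk c a b Ts ?_ l hl ?_ h c3 hT
    · rw [hs]; ext x; simp; tauto
    · rw [← show ({a, b, c} : Finset ℕ) = {c, a, b} by ext x; simp; tauto]; exact hsub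
  · exfalso
    have hc3 := (next_idx h4 hP hle hmem i j hij).1
    have hadj : DualAdj 2 7 σ l j := by
      refine ⟨fun h => ?_, ?_⟩
      · rw [h] at hl; omega
      have h1 : σ i ∩ σ j ⊆ σ l ∩ σ j := by
        intro x hx
        refine Finset.mem_inter.2 ⟨hsub (h ▸ hx), (Finset.mem_inter.1 hx).2⟩
      have h2 := Finset.card_le_card h1
      have h3 : (σ l ∩ σ j).card < (σ j).card := by
        apply Finset.card_lt_card
        refine ⟨Finset.inter_subset_right, fun h => ?_⟩
        have := hle l _ (Finset.mem_inter.1 (h (hmem j))).1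
        omega
      have := h4 j
      show _ = 3
      omega
    have := (hP l j).1 hadj
    omega

theorem base_aux (p q d a b c : ℕ) (h0 : σ 0 = {d, a, b, c}) (hI : σ 0 ∩ σ 1 = {a, b, c})
    (h : start p q d a b c = true) : Inv σ p q 1 5 := by
  rw [start, filt_spec] at h
  have hj := (next_idx h4 hP hle hmem 0 1 rfl).2
  rw [hI] at hj
  have hbd : ∀ x ∈ σ 0, x ≤ 10 := fun x hx => by have := (hle 0 x hx).2; simp at this; omega
  rw [h0] at hbd
  simp only [Finset.mem_insert, Finset.mem_singleton, forall_eq_or_imp, forall_eq] at hbd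
  obtain ⟨hd, ha, hb, hc⟩ := hbd
  refine ⟨a, b, c, _, ?_, ⟨0, rfl, ?_⟩, h, ?_⟩
  · rw [hj]; ext x; simp; tauto
  · rw [← hI]; exact Finset.inter_subset_left
  · intro T hTm
    simp only [List.append_nil, List.mem_reverse, List.mem_filter, Bool.and_eq_true] at hTm
    obtain ⟨hTm, h1, h2, h3, h5⟩ := hTm
    refine ⟨hTm, h1, ?_⟩
    rintro f hf ⟨m, hm, hfm⟩
    have : m = 0 := Fin.ext (by simpa using hm)
    subst this
    have h4i := h4 0
    have hfm' := hfm
    have e : σ 0 = {a, b, c, d} := by rw [h0]; ext x; simp; tauto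
    rw [e] at h4i hfm'
    rcases three_sub hf.1 hfm' h4i with h | h | h | h
    · rw [h]; exact hit_spec h5 hb hc hd
    · rw [h]; exact hit_spec h3 ha hc hd
    · rw [h]; exact hit_spec h2 ha hb hd
    · exfalso
      have : (0 : Fin 7) = 1 := notTwo hf hfm (by rw [h, ← hI]; exact Finset.inter_subset_right)
      simp at this

theorem base (p q : ℕ) (h : startAll p q = true) : Inv σ p q 1 5 := by
  have h0 : σ 0 = {1, 2, 3, 4} := by
    apply Finset.eq_of_subset_of_card_le
    · intro x hx
      have := hle 0 x hx
      simp at this ⊢; omega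
    · rw [h4]; decide
  have h4i := h4 0
  rw [h0] at h4i
  simp only [startAll, Bool.and_eq_true] at h
  obtain ⟨c1, c2, c3, c4⟩ := h
  have hsub' : σ 0 ∩ σ 1 ⊆ {1, 2, 3, 4} := by rw [← h0]; exact Finset.inter_subset_left
  rcases three_sub (next_idx h4 hP hle hmem 0 1 rfl).1 hsub' h4i with h | h | h | h
  · exact base_aux h4 hP hle hmem p q _ _ _ _ h0 h c1
  · exact base_aux h4 hP hle hmem p q _ _ _ _ (by rw [h0]; decide) h c2
  · exact base_aux h4 hP hle hmem p q _ _ _ _ (by rw [h0]; decide) h c3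
  · exact base_aux h4 hP hle hmem p q _ _ _ _ (by rw [h0]; decide) h c4

theorem final (p q : ℕ) (hp : p ≤ 10) (hq : q ≤ 10) (h : startAll p q = true) :
    ∃ T₁ T₂ : Finset ℕ,
      IsTransversal T₁ (sphereFacets 2 7 σ) ∧ IsTransversal T₂ (sphereFacets 2 7 σ) ∧
      T₁.card ≤ 4 ∧ T₂.card ≤ 4 ∧
      (T₁ ∩ {p, q}).Nonempty ∧ (T₂ ∩ {p, q}).Nonempty ∧
      3 ≤ ((σ 6) ∩ (T₁ ∪ T₂)).card := by
  have i1 := base h4 hP hle hmem p q h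
  have i2 := step h4 hP hle hmem p q 1 2 4 rfl rfl i1
  have i3 := step h4 hP hle hmem p q 2 3 3 rfl rfl i2
  have i4 := step h4 hP hle hmem p q 3 4 2 rfl rfl i3
  have i5 := step h4 hP hle hmem p q 4 5 1 rfl rfl i4
  have i6 := step h4 hP hle hmem p q 5 6 0 rfl rfl i5
  obtain ⟨a, b, c, Ts, hs, ⟨l, hl, hsub⟩, hck, hT⟩ := i6
  rw [check, filt_spec] at hck
  have hbd : ∀ x ∈ σ 6, x ≤ 10 := fun x hx => (hle 6 x hx).2
  simp only [Nat.sub_zero] at hs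
  have h46 := h4 6
  rw [hs] at hbd h46
  simp only [Finset.mem_insert, Finset.mem_singleton, forall_eq_or_imp, forall_eq] at hbd
  obtain ⟨ha, hb, hc, hn⟩ := hbd
  have hd := card4 h46
  simp only [fin0, List.any_eq_true, List.append_nil, List.mem_reverse, List.mem_filter,
    Bool.and_eq_true] at hck
  obtain ⟨X, ⟨hX, hX'⟩, Y, ⟨hY, hY'⟩, h3⟩ := hck
  have good : ∀ T ∈ Ts, (hit T a b 10 = true ∧ hit T a c 10 = true ∧ hit T b c 10 = true) →
      IsTransversal (toF T) (sphereFacets 2 7 σ) ∧ (toF T).card ≤ 4 ∧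
        (toF T ∩ {p, q}).Nonempty := by
    rintro T hTm ⟨t1, t2, t3⟩
    obtain ⟨r1, r2, r3⟩ := hT T hTm
    refine ⟨?_, root_card T r1, by simpa using hit_spec r2 hp hq hq⟩
    intro f hf
    obtain ⟨m, hfm, -⟩ := hf.2
    by_cases hm : m.val < 6
    · exact r3 f hf ⟨m, hm, hfm⟩
    have : m = 6 := Fin.ext (by have := m.2; show m.val = 6; omega)
    subst this
    have hfm' := hfm
    rw [hs] at hfm'
    rcases three_sub hf.1 hfm' h46 with h | h | h | h
    · rw [h]; exact hit_spec t3 hb hc hn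
    · rw [h]; exact hit_spec t2 ha hc hn
    · rw [h]; exact hit_spec t1 ha hb hn
    · exfalso
      have : (6 : Fin 7) = l := notTwo hf hfm (by rw [h]; exact hsub)
      rw [← this] at hl; simp at hl
  obtain ⟨x1, x2, x3⟩ := good X hX hX'
  obtain ⟨y1, y2, y3⟩ := good Y hY hY'
  refine ⟨toF X, toF Y, x1, y1, x2, y2, x3, y3, ?_⟩
  have hU : ∀ x, x ∈ toF X ∪ toF Y ↔ x ≤ 10 ∧ (X ||| Y).testBit x = true := by
    intro x
    simp only [Finset.mem_union, mem_toF, Nat.testBit_or, Bool.or_eq_true]; tauto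
  rw [hs]
  generalize toF X ∪ toF Y = U at hU
  have key : ∀ x y z : ℕ, x ≠ y → x ≠ z → y ≠ z → x ∈ ({a, b, c, 10} : Finset ℕ) ∩ U →
      y ∈ ({a, b, c, 10} : Finset ℕ) ∩ U → z ∈ ({a, b, c, 10} : Finset ℕ) ∩ U →
      3 ≤ (({a, b, c, 10} : Finset ℕ) ∩ U).card := by
    intro x y z h1 h2 h3 hx hy hz
    rw [← Finset.card_eq_three.2 ⟨x, y, z, h1, h2, h3, rfl⟩]
    apply Finset.card_le_card
    intro w hw
    simp only [Finset.mem_insert, Finset.mem_singleton] at hw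
    rcases hw with rfl | rfl | rfl <;> assumption
  obtain ⟨d1, d2, d3, d4, d5, d6⟩ := hd
  have A : ∀ x, (x = a ∨ x = b ∨ x = c ∨ x = 10) → (X ||| Y).testBit x = true →
      x ∈ ({a, b, c, 10} : Finset ℕ) ∩ U := by
    intro x hx hx'
    have : x ≤ 10 := by omega
    simp only [Finset.mem_inter, Finset.mem_insert, Finset.mem_singleton]
    exact ⟨hx, (hU x).2 ⟨this, hx'⟩⟩
  have Aa := A a (by simp)
  have Ab := A b (by simp)
  have Ac := A c (by simp)
  have An := A 10 (by simp)
  simp only [three, Bool.and_eq_true, Bool.or_eq_true] at h3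
  rcases h3 with ⟨n1, ⟨a1, b1 | c1⟩ | ⟨b1, c1⟩⟩ | ⟨a1, b1, c1⟩
  · exact key a b 10 d1 d3 d5 (Aa a1) (Ab b1) (An n1)
  · exact key a c 10 d2 d3 d6 (Aa a1) (Ac c1) (An n1)
  · exact key b c 10 d4 d5 d6 (Ab b1) (Ac c1) (An n1)
  · exact key a b c d1 d2 d4 (Aa a1) (Ab b1) (Ac c1)

end

end KeyTen

/-- **Lemma (key lemma on 10 vertices).** Let `S = ∂(σ₁,…,σ₇)` be a stacked `2`-sphere
on `{1,…,10}` where `σ_i = {α_i, β_i, γ_i, i+3}` with `α_i, β_i, γ_i < i+3` (the dual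
graph being a path in this order and vertices labeled in order of appearance). Then for
every `2`-element subset `L ⊆ {1,2,3}` there are transversals `T₁, T₂` of `S` of size
at most `4` with `T₁ ∩ L ≠ ∅`, `T₂ ∩ L ≠ ∅` and `|σ₇ ∩ (T₁ ∪ T₂)| ≥ 3`. -/
theorem key_lemma_ten_vertices (σ : Fin 7 → Finset ℕ)
    (hB : IsStackedBall 2 7 σ) (hP : IsPathOrder 2 7 σ)
    (hV : vertexSet 7 σ = Finset.Icc 1 10)
    (hσ : ∀ i : Fin 7, ∃ a b c : ℕ, a < i.val + 4 ∧ b < i.val + 4 ∧ c < i.val + 4 ∧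
      σ i = {a, b, c, i.val + 4})
    (L : Finset ℕ) (hL : L ⊆ {1, 2, 3}) (hLcard : L.card = 2) :
    ∃ T₁ T₂ : Finset ℕ,
      IsTransversal T₁ (sphereFacets 2 7 σ) ∧ IsTransversal T₂ (sphereFacets 2 7 σ) ∧
      T₁.card ≤ 4 ∧ T₂.card ≤ 4 ∧
      (T₁ ∩ L).Nonempty ∧ (T₂ ∩ L).Nonempty ∧
      3 ≤ ((σ 6) ∩ (T₁ ∪ T₂)).card := by
  have h4 := hB.1
  have hle : ∀ i, ∀ x ∈ σ i, 1 ≤ x ∧ x ≤ i.val + 4 := by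
    intro i x hx
    have h1 : x ∈ vertexSet 7 σ := Finset.mem_biUnion.2 ⟨i, Finset.mem_univ _, hx⟩
    rw [hV, Finset.mem_Icc] at h1
    obtain ⟨a, b, c, ha, hb, hc, hs⟩ := hσ i
    rw [hs] at hx
    simp only [Finset.mem_insert, Finset.mem_singleton] at hx
    omega
  have hmem : ∀ i, i.val + 4 ∈ σ i := by
    intro i
    obtain ⟨a, b, c, ha, hb, hc, hs⟩ := hσ i
    rw [hs]; simp
  have hLc : L = {1, 2} ∨ L = {1, 3} ∨ L = {2, 3} := by
    have : L ∈ ({1, 2, 3} : Finset ℕ).powersetCard 2 := Finset.mem_powersetCard.2 ⟨hL, hLcard⟩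
    have e : ({1, 2, 3} : Finset ℕ).powersetCard 2 = {{1, 2}, {1, 3}, {2, 3}} := by decide
    rw [e] at this
    simpa using this
  rcases hLc with rfl | rfl | rfl
  · exact KeyTen.final h4 hP hle hmem 1 2 (by norm_num) (by norm_num) KeyTen.start12
  · exact KeyTen.final h4 hP hle hmem 1 3 (by norm_num) (by norm_num) KeyTen.start13
  · exact KeyTen.final h4 hP hle hmem 2 3 (by norm_num) (by norm_num) KeyTen.start23
end

section
/- Let n ≥ 4 and let S = ∂(σ₁,…,σ_{n−3}) be a linear stacked 2-sphere on n vertices (the dual graph being a path in this order). Then there exist transversals T₁ and T₂ of S, each of size at most ⌈3n/7⌉, such that T₁ ∪ T₂ contains at least 3 vertices of σ_{n−3}. -/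
open Finset

/-- Tables of cost profiles, one list per residue mod 7; base-4 digits. -/
def tbl : ℕ → List ℕ
  | 0 => [4205159760, 3936982356, 3936785745, 3212803903]
  | 1 => [2840941568, 2790609152, 3918844992, 3077796659, 2134851391]
  | 2 => [3127207184, 3936720208, 2859029780, 2858833169, 3078058803, 2139045695]
  | 3 => [2773831680, 2840876032, 2790347008, 2134851391]
  | 4 => [3935671616, 2858767632, 2594522448, 3919025219, 3078058803, 2139045695]
  | 5 => [2505392128, 2773766144, 2773569536, 2134851391]
  | _ => [2857719040, 3918894144, 2794803520, 3078058803, 2139045695]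

def bn (p : Bool) : ℕ := cond p 1 0

def dlt (r : ℕ) : ℕ := cond (r == 0 || r == 2 || r == 4) 1 0

/-- A profile assigns to each mask a cost (3 = no claim). -/
abbrev Prof := Bool → Bool → Bool → Bool → ℕ

def dec (P : ℕ) : Prof := fun p q r s =>
  (P / 4 ^ (bn p + 2 * bn q + 4 * bn r + 8 * bn s)) % 4

def s12 (P : Prof) : Prof := fun p q r s => P q p r s
def s23 (P : Prof) : Prof := fun p q r s => P p r q s

def hitb (p q r s : Bool) : Bool := p || s || (q && r)

/-- one candidate value -/
def cand (d : ℕ) (P : Prof) (w p q r x : Bool) : ℕ :=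
  cond (hitb w p q r && Nat.blt (P w p q r) 3) (P w p q r + bn x - d) 3

def stepP (d : ℕ) (P : Prof) : Prof := fun p q r x =>
  cond (Nat.ble (cand d P true p q r x) (cand d P false p q r x))
    (cand d P true p q r x) (cand d P false p q r x)

def allB (f : Bool → Bool) : Bool := f true && f false
def anyB (f : Bool → Bool) : Bool := f true || f false

theorem allB_iff (f : Bool → Bool) : allB f = true ↔ ∀ b, f b = true := by
  simp [allB, and_comm]

theorem anyB_iff (f : Bool → Bool) : anyB f = true ↔ ∃ b, f b = true := by
  simp [anyB, or_comm]

def leb (Q P : Prof) : Bool :=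
  allB fun p => allB fun q => allB fun r => allB fun s =>
    Nat.ble 3 (P p q r s) || Nat.ble (Q p q r s) (P p q r s)

def covered (t : List ℕ) (Q : Prof) : Bool :=
  t.any fun c => leb Q (dec c) || leb (s12 Q) (dec c) || leb (s23 Q) (dec c) ||
    leb (s12 (s23 Q)) (dec c) || leb (s23 (s12 Q)) (dec c) || leb (s12 (s23 (s12 Q))) (dec c)

def closedb (r : ℕ) : Bool :=
  (tbl r).all fun c =>
    covered (tbl ((r + 1) % 7)) (stepP (dlt r) (dec c)) &&
    covered (tbl ((r + 1) % 7)) (stepP (dlt r) (s12 (dec c))) &&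
    covered (tbl ((r + 1) % 7)) (stepP (dlt r) (s12 (s23 (dec c))))

def fin4 (p q r s : Bool) : Bool := s || (p && q) || (p && r) || (q && r)

def okb (P : Prof) : Bool :=
  anyB fun p => anyB fun q => anyB fun r => anyB fun s =>
    fin4 p q r s && Nat.ble (P p q r s) 1 &&
  anyB fun p' => anyB fun q' => anyB fun r' => anyB fun s' =>
    fin4 p' q' r' s' && Nat.ble (P p' q' r' s') 1 &&
    (((p || p') && (q || q') && (r || r')) || ((p || p') && (q || q') && (s || s')) ||
      ((p || p') && (r || r') && (s || s')) || ((q || q') && (r || r') && (s || s')))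

theorem closed_all : ∀ r, r < 7 → closedb r = true := by decide +kernel

theorem ok_all : ∀ r, r < 7 → ((tbl r).all fun c => okb (dec c)) = true := by decide +kernel

/-- partial transversals of the first `k+1` simplices -/
def VT (s : ℕ → Finset ℕ) (k v : ℕ) (T : Finset ℕ) : Prop :=
  (∀ t ∈ T, ∃ i, i ≤ k ∧ t ∈ s i) ∧
  ∀ f : Finset ℕ, f.card = 3 → ∀ i, i ≤ k → f ⊆ s i →
    (∀ j, j ≤ k → j ≠ i → ¬ f ⊆ s j) → (i = k → v ∉ f) → (T ∩ f).Nonempty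

def Has (s : ℕ → Finset ℕ) (k a b c v : ℕ) (P : Prof) (K : ℕ) : Prop :=
  ∀ p q r t : Bool, P p q r t < 3 → ∃ T, VT s k v T ∧
    (a ∈ T ↔ p = true) ∧ (b ∈ T ↔ q = true) ∧ (c ∈ T ↔ r = true) ∧ (v ∈ T ↔ t = true) ∧
    T.card + 1 ≤ K + P p q r t

theorem Has.sw12 {s : ℕ → Finset ℕ} {k a b c v : ℕ} {P : Prof} {K : ℕ}
    (h : Has s k a b c v P K) : Has s k b a c v (s12 P) K := by
  intro p q r t hp
  obtain ⟨T, h1, h2, h3, h4, h5, h6⟩ := h q p r t hp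
  exact ⟨T, h1, h3, h2, h4, h5, h6⟩

theorem Has.sw23 {s : ℕ → Finset ℕ} {k a b c v : ℕ} {P : Prof} {K : ℕ}
    (h : Has s k a b c v P K) : Has s k a c b v (s23 P) K := by
  intro p q r t hp
  obtain ⟨T, h1, h2, h3, h4, h5, h6⟩ := h p r q t hp
  exact ⟨T, h1, h2, h4, h3, h5, h6⟩

theorem leb_spec {Q P : Prof} (h : leb Q P = true) (p q r t : Bool) :
    3 ≤ P p q r t ∨ Q p q r t ≤ P p q r t := by
  simp only [leb, allB_iff, Bool.or_eq_true, Nat.ble_eq] at h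
  exact h p q r t

theorem Has.weaken {s : ℕ → Finset ℕ} {k a b c v : ℕ} {P Q : Prof} {K : ℕ}
    (h : Has s k a b c v Q K) (hl : leb Q P = true) : Has s k a b c v P K := by
  intro p q r t hp
  have := leb_spec hl p q r t
  obtain ⟨T, h1, h2, h3, h4, h5, h6⟩ := h p q r t (by omega)
  exact ⟨T, h1, h2, h3, h4, h5, by omega⟩

theorem VT_step {s : ℕ → Finset ℕ} {k a b c v x : ℕ} {T : Finset ℕ}
    (hs : s k = {a, b, c, v}) (hs' : s (k + 1) = {b, c, v, x})
    (hT : VT s k v T) (hh : a ∈ T ∨ v ∈ T ∨ (b ∈ T ∧ c ∈ T))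
    (T' : Finset ℕ) (hT' : T ⊆ T') (hT'' : T' ⊆ insert x T) : VT s (k + 1) x T' := by
  refine ⟨?_, ?_⟩
  · intro t ht
    have := hT'' ht
    rw [Finset.mem_insert] at this
    rcases this with rfl | h
    · exact ⟨k + 1, le_rfl, by simp [hs']⟩
    · obtain ⟨i, hi, h⟩ := hT.1 t h
      exact ⟨i, by omega, h⟩
  · intro f hf i hi hfi hu hx
    have mono : (T ∩ f).Nonempty → (T' ∩ f).Nonempty := fun h =>
      h.mono (Finset.inter_subset_inter_right hT')
    by_cases hik : i = k + 1
    · exfalso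
      subst hik
      apply hu k (by omega) (by omega)
      intro y hy
      have h1 := hfi hy
      have h2 : y ≠ x := fun h => hx rfl (h ▸ hy)
      rw [hs'] at h1
      rw [hs]
      simp only [Finset.mem_insert, Finset.mem_singleton] at h1 ⊢
      tauto
    · apply mono
      by_cases hc : i = k → v ∉ f
      · exact hT.2 f hf i (by omega) hfi (fun j hj => hu j (by omega)) hc
      · push Not at hc
        obtain ⟨rfl, hv⟩ := hc
        have ha : a ∈ f := by
          by_contra ha
          apply hu (i + 1) (by omega) (by omega)
          intro y hy
          have h1 := hfi hy
          have h2 : y ≠ a := fun h => ha (h ▸ hy)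
          rw [hs] at h1
          rw [hs']
          simp only [Finset.mem_insert, Finset.mem_singleton] at h1 ⊢
          tauto
        rcases hh with h | h | ⟨h1, h2⟩
        · exact ⟨a, by simp [*]⟩
        · exact ⟨v, by simp [*]⟩
        · by_cases hb : b ∈ f
          · exact ⟨b, by simp [*]⟩
          by_cases hc : c ∈ f
          · exact ⟨c, by simp [*]⟩
          exfalso
          have : f ⊆ {a, v} := by
            intro y hy
            have h1 := hfi hy
            have h2 : y ≠ b := fun h => hb (h ▸ hy)
            have h3 : y ≠ c := fun h => hc (h ▸ hy)
            rw [hs] at h1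
            simp only [Finset.mem_insert, Finset.mem_singleton] at h1 ⊢
            tauto
          have := Finset.card_le_card this
          have := Finset.card_le_two (a := a) (b := v)
          omega

theorem stepP_spec {d : ℕ} {P : Prof} {p q r x : Bool} (h : stepP d P p q r x < 3) :
    ∃ w, hitb w p q r = true ∧ P w p q r < 3 ∧
      stepP d P p q r x = P w p q r + bn x - d := by
  have key : ∀ w, cand d P w p q r x < 3 → hitb w p q r = true ∧ P w p q r < 3 ∧
      cand d P w p q r x = P w p q r + bn x - d := by
    intro w hw
    unfold cand at hw ⊢
    cases hc : (hitb w p q r && Nat.blt (P w p q r) 3) with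
    | false => simp [hc] at hw
    | true =>
      simp only [Bool.and_eq_true, Nat.blt_eq] at hc
      exact ⟨hc.1, hc.2, rfl⟩
  unfold stepP at h ⊢
  cases hc : Nat.ble (cand d P true p q r x) (cand d P false p q r x) with
  | false =>
    rw [hc] at h
    exact ⟨false, key false h⟩
  | true =>
    rw [hc] at h
    exact ⟨true, key true h⟩

theorem Has.step {s : ℕ → Finset ℕ} {k a b c v x : ℕ} {P : Prof} {K d : ℕ}
    (h : Has s k a b c v P K)
    (hs : s k = {a, b, c, v}) (hs' : s (k + 1) = {b, c, v, x})
    (hx : ∀ i, i ≤ k → x ∉ s i) :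
    Has s (k + 1) b c v x (stepP d P) (K + d) := by
  intro p q r t hp
  obtain ⟨w, hw, hw3, he⟩ := stepP_spec hp
  obtain ⟨T, h1, h2, h3, h4, h5, h6⟩ := h w p q r hw3
  have hh : a ∈ T ∨ v ∈ T ∨ (b ∈ T ∧ c ∈ T) := by
    rw [h2, h3, h4, h5]
    simp only [hitb, Bool.or_eq_true, Bool.and_eq_true] at hw
    tauto
  have hxT : x ∉ T := fun hm => by
    obtain ⟨i, hi, hm⟩ := h1.1 x hm
    exact hx i hi hm
  have hxk := hx k le_rfl
  rw [hs] at hxk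
  simp only [Finset.mem_insert, Finset.mem_singleton, not_or] at hxk
  obtain ⟨xa, xb, xc, xv⟩ := hxk
  rw [he]
  cases t with
  | false =>
    refine ⟨T, VT_step hs hs' h1 hh T (Finset.Subset.refl _) (Finset.subset_insert _ _),
      h3, h4, h5, by simp [hxT], ?_⟩
    simp only [bn, cond]
    omega
  | true =>
    refine ⟨insert x T, VT_step hs hs' h1 hh _ (Finset.subset_insert _ _) (Finset.Subset.refl _),
      ?_, ?_, ?_, by simp, ?_⟩
    · rw [Finset.mem_insert, h3]; simp [Ne.symm xb]
    · rw [Finset.mem_insert, h4]; simp [Ne.symm xc]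
    · rw [Finset.mem_insert, h5]; simp [Ne.symm xv]
    · rw [Finset.card_insert_of_notMem hxT]
      simp only [bn, cond]
      omega

def G (s : ℕ → Finset ℕ) (t : List ℕ) (K k v : ℕ) : Prop :=
  ∃ a b c, s k = {a, b, c, v} ∧ ∃ P ∈ t, Has s k a b c v (dec P) K

theorem perm12 (a b c v : ℕ) : ({a, b, c, v} : Finset ℕ) = {b, a, c, v} := by
  ext y; simp only [Finset.mem_insert, Finset.mem_singleton]; tauto

theorem perm23 (a b c v : ℕ) : ({a, b, c, v} : Finset ℕ) = {a, c, b, v} := by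
  ext y; simp only [Finset.mem_insert, Finset.mem_singleton]; tauto

theorem G_of_covered {s : ℕ → Finset ℕ} {k a b c v : ℕ} {Q : Prof} {K : ℕ} {t : List ℕ}
    (h : Has s k a b c v Q K) (hs : s k = {a, b, c, v}) (hc : covered t Q = true) :
    G s t K k v := by
  unfold covered at hc
  rw [List.any_eq_true] at hc
  obtain ⟨P, hP, hc⟩ := hc
  simp only [Bool.or_eq_true] at hc
  rcases hc with ((((hc | hc) | hc) | hc) | hc) | hc
  · exact ⟨_, _, _, hs, P, hP, h.weaken hc⟩
  · exact ⟨_, _, _, by rw [hs, perm12], P, hP, h.sw12.weaken hc⟩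
  · exact ⟨_, _, _, by rw [hs, perm23], P, hP, h.sw23.weaken hc⟩
  · exact ⟨_, _, _, by rw [hs, perm23, perm12], P, hP, h.sw23.sw12.weaken hc⟩
  · exact ⟨_, _, _, by rw [hs, perm12, perm23], P, hP, h.sw12.sw23.weaken hc⟩
  · exact ⟨_, _, _, by rw [hs, perm12, perm23, perm12], P, hP, h.sw12.sw23.sw12.weaken hc⟩

theorem G_step_a {s : ℕ → Finset ℕ} {k a b c v x y : ℕ} {P : Prof} {K d : ℕ} {t : List ℕ}
    (h : Has s k a b c v P K) (hs : s k = {a, b, c, v}) (h4 : (s k).card = 4)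
    (hs' : s (k + 1) = insert x ((s k).erase y)) (hy : y = a)
    (hx : ∀ i, i ≤ k → x ∉ s i) (hc : covered t (stepP d P) = true) :
    G s t (K + d) (k + 1) x := by
  subst hy
  have hs'' : s (k + 1) = {b, c, v, x} := by
    have : y ∉ ({b, c, v} : Finset ℕ) := by
      intro hm
      rw [hs, Finset.insert_eq_of_mem hm] at h4
      have := Finset.card_le_three (a := b) (b := c) (c := v)
      omega
    rw [hs', hs, Finset.erase_insert this]
    ext z; simp only [Finset.mem_insert, Finset.mem_singleton]; tauto
  exact G_of_covered (h.step hs hs'' hx) hs'' hc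

theorem G_step {s : ℕ → Finset ℕ} {k v x y r K : ℕ} (hr : r < 7)
    (h : G s (tbl r) K k v) (h4 : (s k).card = 4) (hy : y ∈ s k) (hyv : y ≠ v)
    (hs' : s (k + 1) = insert x ((s k).erase y))
    (hx : ∀ i, i ≤ k → x ∉ s i) :
    G s (tbl ((r + 1) % 7)) (K + dlt r) (k + 1) x := by
  obtain ⟨a, b, c, hs, P, hP, h⟩ := h
  have hc := closed_all r hr
  unfold closedb at hc
  rw [List.all_eq_true] at hc
  have hc := hc P hP
  simp only [Bool.and_eq_true] at hc
  obtain ⟨⟨c1, c2⟩, c3⟩ := hc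
  rw [hs] at hy
  simp only [Finset.mem_insert, Finset.mem_singleton] at hy
  rcases hy with hy | hy | hy | hy
  · exact G_step_a h hs h4 hs' hy hx c1
  · exact G_step_a h.sw12 (by rw [hs, perm12]) h4 hs' hy hx c2
  · exact G_step_a h.sw23.sw12 (by rw [hs, perm23, perm12]) h4 hs' hy hx c3
  · exact absurd hy hyv

theorem okb_spec {P : Prof} (h : okb P = true) : ∃ p q r t p' q' r' t' : Bool,
    fin4 p q r t = true ∧ P p q r t ≤ 1 ∧ fin4 p' q' r' t' = true ∧ P p' q' r' t' ≤ 1 ∧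
    (((p || p') && (q || q') && (r || r')) || ((p || p') && (q || q') && (t || t')) ||
      ((p || p') && (r || r') && (t || t')) || ((q || q') && (r || r') && (t || t'))) = true := by
  unfold okb at h
  simp only [anyB_iff, Bool.and_eq_true (fin4 _ _ _ _ && _), Bool.and_eq_true (fin4 _ _ _ _),
    Nat.ble_eq] at h
  obtain ⟨p, q, r, t, ⟨h1, h2⟩, p', q', r', t', ⟨h3, h4⟩, h5⟩ := h
  exact ⟨p, q, r, t, p', q', r', t', h1, h2, h3, h4, h5⟩

theorem final_hit {s : ℕ → Finset ℕ} {k a b c v : ℕ} {T : Finset ℕ}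
    (hs : s k = {a, b, c, v}) (hT : VT s k v T) {p q r t : Bool}
    (ha : a ∈ T ↔ p = true) (hb : b ∈ T ↔ q = true) (hc : c ∈ T ↔ r = true)
    (hv : v ∈ T ↔ t = true) (hf : fin4 p q r t = true)
    (f : Finset ℕ) (hf3 : f.card = 3) (i : ℕ) (hi : i ≤ k) (hfi : f ⊆ s i)
    (hu : ∀ j, j ≤ k → j ≠ i → ¬ f ⊆ s j) : (T ∩ f).Nonempty := by
  by_cases hcc : i = k → v ∉ f
  · exact hT.2 f hf3 i hi hfi hu hcc
  push Not at hcc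
  obtain ⟨rfl, hvf⟩ := hcc
  by_contra hne
  have hno : ∀ y ∈ T, y ∉ f := fun y hy hyf => hne ⟨y, by simp [*]⟩
  have key : ∀ y z w, s i = {y, z, w, v} → y ∈ T → z ∈ T → False := by
    intro y z w he hy hz
    have : f ⊆ {w, v} := by
      intro u hu
      have h1 := hfi hu
      have h2 : u ≠ y := fun h => hno y hy (h ▸ hu)
      have h3 : u ≠ z := fun h => hno z hz (h ▸ hu)
      rw [he] at h1
      simp only [Finset.mem_insert, Finset.mem_singleton] at h1 ⊢
      tauto
    have := Finset.card_le_card this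
    have := Finset.card_le_two (a := w) (b := v)
    omega
  simp only [fin4, Bool.or_eq_true, Bool.and_eq_true, ← ha, ← hb, ← hc, ← hv] at hf
  rcases hf with ((hf | hf) | hf) | hf
  · exact hno v hf hvf
  · exact key a b c hs hf.1 hf.2
  · exact key a c b (by rw [hs, perm23]) hf.1 hf.2
  · exact key b c a (by rw [hs, perm12, perm23]) hf.1 hf.2

theorem three_le {S : Finset ℕ} {a b c : ℕ} (hab : a ≠ b) (hac : a ≠ c) (hbc : b ≠ c)
    (ha : a ∈ S) (hb : b ∈ S) (hc : c ∈ S) : 3 ≤ S.card := by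
  have : ({a, b, c} : Finset ℕ) ⊆ S := by
    intro y; simp only [Finset.mem_insert, Finset.mem_singleton]; rintro (rfl | rfl | rfl) <;> assumption
  have h := Finset.card_le_card this
  rwa [Finset.card_eq_three.2 ⟨a, b, c, hab, hac, hbc, rfl⟩] at h

theorem ne_of_card {a b c v : ℕ} (h : ({a, b, c, v} : Finset ℕ).card = 4) :
    a ≠ b ∧ a ≠ c ∧ a ≠ v ∧ b ≠ c ∧ b ≠ v ∧ c ≠ v := by
  have h3 := fun a b c : ℕ => Finset.card_le_three (a := a) (b := b) (c := c)
  refine ⟨?_, ?_, ?_, ?_, ?_, ?_⟩ <;> rintro rfl <;> simp at h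
  · have := h3 a c v; omega
  · have := h3 b a v; omega
  · have := h3 b c a; omega
  · have := h3 a b v; omega
  · have := h3 a c b; omega
  · have := h3 a b c; omega

theorem G_final {s : ℕ → Finset ℕ} {k v r K : ℕ} (hr : r < 7)
    (h : G s (tbl r) K k v) (h4 : (s k).card = 4) :
    ∃ T₁ T₂ : Finset ℕ,
      (∀ f : Finset ℕ, f.card = 3 → ∀ i, i ≤ k → f ⊆ s i →
        (∀ j, j ≤ k → j ≠ i → ¬ f ⊆ s j) → (T₁ ∩ f).Nonempty) ∧
      (∀ f : Finset ℕ, f.card = 3 → ∀ i, i ≤ k → f ⊆ s i →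
        (∀ j, j ≤ k → j ≠ i → ¬ f ⊆ s j) → (T₂ ∩ f).Nonempty) ∧
      T₁.card ≤ K ∧ T₂.card ≤ K ∧ 3 ≤ (s k ∩ (T₁ ∪ T₂)).card := by
  obtain ⟨a, b, c, hs, P, hP, h⟩ := h
  have ho := ok_all r hr
  rw [List.all_eq_true] at ho
  obtain ⟨p, q, r, t, p', q', r', t', h1, h2, h3, h4', h5⟩ := okb_spec (ho P hP)
  obtain ⟨T, g1, g2, g3, g4, g5, g6⟩ := h p q r t (by omega)
  obtain ⟨T', g1', g2', g3', g4', g5', g6'⟩ := h p' q' r' t' (by omega)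
  refine ⟨T, T', final_hit hs g1 g2 g3 g4 g5 h1, final_hit hs g1' g2' g3' g4' g5' h3,
    by omega, by omega, ?_⟩
  rw [hs] at h4 ⊢
  obtain ⟨n1, n2, n3, n4, n5, n6⟩ := ne_of_card h4
  simp only [Bool.or_eq_true, Bool.and_eq_true, ← g2, ← g3, ← g4, ← g5, ← g2', ← g3', ← g4',
    ← g5'] at h5
  rcases h5 with ((⟨⟨x, y⟩, z⟩ | ⟨⟨x, y⟩, z⟩) | ⟨⟨x, y⟩, z⟩) | ⟨⟨x, y⟩, z⟩
  · exact three_le n1 n2 n4 (by simp [x]) (by simp [y]) (by simp [z])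
  · exact three_le n1 n3 n5 (by simp [x]) (by simp [y]) (by simp [z])
  · exact three_le n2 n3 n6 (by simp [x]) (by simp [y]) (by simp [z])
  · exact three_le n4 n5 n6 (by simp [x]) (by simp [y]) (by simp [z])

theorem G_base {s : ℕ → Finset ℕ} {v : ℕ} (h4 : (s 0).card = 4) (hv : v ∈ s 0) :
    G s (tbl 4) 2 0 v := by
  have h3 : ((s 0).erase v).card = 3 := by rw [Finset.card_erase_of_mem hv, h4]
  obtain ⟨a, b, c, hab, hac, hbc, he⟩ := Finset.card_eq_three.1 h3
  have hs : s 0 = {a, b, c, v} := by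
    rw [← Finset.insert_erase hv, he]
    ext y; simp only [Finset.mem_insert, Finset.mem_singleton]; tauto
  obtain ⟨n1, n2, n3, n4, n5, n6⟩ := ne_of_card (hs ▸ h4)
  let Q : Prof := fun p q r t => cond (p || q || r) (bn p + bn q + bn r + bn t - 1) 3
  refine G_of_covered (Q := Q) (a := a) (b := b) (c := c) ?_ hs (by decide +kernel)
  intro p q r t hQ
  have hpqr : (p || q || r) = true := by
    by_contra hh
    simp only [Bool.not_eq_true] at hh
    simp [Q, hh] at hQ
  let T : Finset ℕ := (cond p {a} ∅) ∪ (cond q {b} ∅) ∪ (cond r {c} ∅) ∪ (cond t {v} ∅)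
  have hT : T ⊆ s 0 := by
    intro y hy
    rw [hs]
    cases p <;> cases q <;> cases r <;> cases t <;> simp [T] at hy ⊢ <;> tauto
  have ma : a ∈ T ↔ p = true := by
    cases p <;> cases q <;> cases r <;> cases t <;> simp [T, *]
  have mb : b ∈ T ↔ q = true := by
    cases p <;> cases q <;> cases r <;> cases t <;> simp [T, *, Ne.symm n1]
  have mc : c ∈ T ↔ r = true := by
    cases p <;> cases q <;> cases r <;> cases t <;> simp [T, *, Ne.symm n2, Ne.symm n4]
  have mv : v ∈ T ↔ t = true := by
    cases p <;> cases q <;> cases r <;> cases t <;>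
      simp [T, Ne.symm n3, Ne.symm n5, Ne.symm n6]
  refine ⟨T, ⟨fun y hy => ⟨0, le_rfl, hT hy⟩, ?_⟩, ma, mb, mc, mv, ?_⟩
  · intro f hf i hi hfi _ hvf
    obtain rfl : i = 0 := by omega
    have hvf := hvf rfl
    have : f = (s 0).erase v := Finset.eq_of_subset_of_card_le
      (fun y hy => Finset.mem_erase.2 ⟨fun h => hvf (h ▸ hy), hfi hy⟩) (by omega)
    rw [this, he]
    simp only [Bool.or_eq_true, ← ma, ← mb, ← mc] at hpqr
    rcases hpqr with (h | h) | h
    · exact ⟨a, by simp [h]⟩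
    · exact ⟨b, by simp [h]⟩
    · exact ⟨c, by simp [h]⟩
  · have hcard : T.card ≤ bn p + bn q + bn r + bn t := by
      have hc : ∀ (w : Bool) (y : ℕ), (cond w {y} ∅ : Finset ℕ).card = bn w := by
        intro w y; cases w <;> simp [bn]
      have e1 := Finset.card_union_le ((cond p {a} ∅) ∪ (cond q {b} ∅) ∪ (cond r {c} ∅))
        (cond t {v} ∅)
      have e2 := Finset.card_union_le ((cond p {a} ∅) ∪ (cond q {b} ∅)) (cond r {c} ∅)
      have e3 := Finset.card_union_le (cond p {a} ∅) (cond q {b} ∅)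
      rw [hc] at e1 e2 e3
      rw [hc] at e3
      simp only [T]
      omega
    have : Q p q r t = bn p + bn q + bn r + bn t - 1 := by simp [Q, hpqr]
    rw [this]
    omega

/-- main induction -/
theorem main_ind (s : ℕ → Finset ℕ) (m : ℕ)
    (h4 : ∀ k, k < m → (s k).card = 4) (x y : ℕ → ℕ)
    (hy : ∀ k, k + 1 < m → y k ∈ s k)
    (hs : ∀ k, k + 1 < m → s (k + 1) = insert (x (k + 1)) ((s k).erase (y k)))
    (hx : ∀ k, k + 1 < m → ∀ i, i ≤ k → x (k + 1) ∉ s i)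
    (hxy : ∀ k, k + 2 < m → y (k + 1) ≠ x (k + 1)) :
    ∀ k, k < m → ∃ v, (k + 1 < m → y k ≠ v) ∧
      G s (tbl ((k + 4) % 7)) ((3 * (k + 4) + 6) / 7) k v := by
  intro k
  induction k with
  | zero =>
    intro hm
    have hv : ∃ v ∈ s 0, v ≠ y 0 := Finset.exists_mem_ne (by rw [h4 0 hm]; omega) _
    obtain ⟨v, hv, hvy⟩ := hv
    exact ⟨v, fun _ => hvy.symm, G_base (h4 0 hm) hv⟩
  | succ k ih =>
    intro hm
    obtain ⟨v, hv, hG⟩ := ih (by omega)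
    refine ⟨x (k + 1), fun h => hxy k h, ?_⟩
    have := G_step (Nat.mod_lt _ (by omega)) hG (h4 k (by omega)) (hy k hm) (hv hm) (hs k hm)
      (hx k hm)
    have e1 : ((k + 4) % 7 + 1) % 7 = (k + 1 + 4) % 7 := by omega
    have e2 : (3 * (k + 4) + 6) / 7 + dlt ((k + 4) % 7) = (3 * (k + 1 + 4) + 6) / 7 := by
      have hlt : (k + 4) % 7 < 7 := Nat.mod_lt _ (by omega)
      generalize hr : (k + 4) % 7 = r at hlt
      interval_cases r <;> simp [dlt] <;> omega
    rw [e1, e2] at this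
    exact this

theorem structure_step {m : ℕ} (σ : Fin m → Finset ℕ)
    (hB : IsStackedBall 2 m σ) (hP : IsPathOrder 2 m σ) (k : ℕ) (hk : k + 1 < m) :
    ∃ x y, y ∈ σ ⟨k, by omega⟩ ∧
      σ ⟨k + 1, hk⟩ = insert x ((σ ⟨k, by omega⟩).erase y) ∧
      ∀ i : Fin m, i.val ≤ k → x ∉ σ i := by
  obtain ⟨hc, hB⟩ := hB
  obtain ⟨η, hη, hsub, -, hm⟩ := hB ⟨k + 1, hk⟩ (by simp)
  have hadj := ((hP ⟨k, by omega⟩ ⟨k + 1, hk⟩).2 (Or.inl rfl)).2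
  have hsubη : σ ⟨k, by omega⟩ ∩ σ ⟨k + 1, hk⟩ ⊆ η :=
    (hm _ Finset.inter_subset_right).1 ⟨⟨k, by omega⟩, by simp, Finset.inter_subset_left⟩
  have heq : σ ⟨k, by omega⟩ ∩ σ ⟨k + 1, hk⟩ = η :=
    Finset.eq_of_subset_of_card_le hsubη (by omega)
  have hηk : η ⊆ σ ⟨k, by omega⟩ := heq ▸ Finset.inter_subset_left
  have c1 := hc ⟨k, by omega⟩
  have c2 := hc ⟨k + 1, hk⟩
  obtain ⟨x, hx⟩ : ∃ x, σ ⟨k + 1, hk⟩ \ η = {x} := by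
    rw [← Finset.card_eq_one, Finset.card_sdiff_of_subset hsub]; omega
  obtain ⟨y, hy⟩ : ∃ y, σ ⟨k, by omega⟩ \ η = {y} := by
    rw [← Finset.card_eq_one, Finset.card_sdiff_of_subset hηk]; omega
  have hxm : x ∈ σ ⟨k + 1, hk⟩ \ η := by rw [hx]; simp
  have hym : y ∈ σ ⟨k, by omega⟩ \ η := by rw [hy]; simp
  rw [Finset.mem_sdiff] at hxm hym
  refine ⟨x, y, hym.1, ?_, ?_⟩
  · have e1 : (σ ⟨k, by omega⟩).erase y = η := by
      rw [Finset.erase_eq, ← hy, Finset.sdiff_sdiff_eq_self hηk]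
    rw [e1, Finset.insert_eq, ← hx, Finset.sdiff_union_of_subset hsub]
  · intro i hi hxi
    apply hxm.2
    have := (hm {x} (by simpa using hxm.1)).1 ⟨i, by simp; omega, by simpa using hxi⟩
    simpa using this

/-- **Strengthened upper bound.** Let `S = ∂(σ₁,…,σ_{n−3})` be a linear stacked
`2`-sphere on `n ≥ 4` vertices (dual graph a path in this order). Then there are
transversals `T₁, T₂` of `S`, each of size at most `⌈3n/7⌉` (which is `(3n+6)/7`
in `ℕ`), such that `T₁ ∪ T₂` contains at least `3` vertices of `σ_{n−3}`. -/
theorem upper_bound_strong (n : ℕ) (hn : 4 ≤ n)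
    (σ : Fin (n - 3) → Finset ℕ)
    (hB : IsStackedBall 2 (n - 3) σ) (hP : IsPathOrder 2 (n - 3) σ)
    (hV : (vertexSet (n - 3) σ).card = n) :
    ∃ T₁ T₂ : Finset ℕ,
      IsTransversal T₁ (sphereFacets 2 (n - 3) σ) ∧
      IsTransversal T₂ (sphereFacets 2 (n - 3) σ) ∧
      T₁.card ≤ (3 * n + 6) / 7 ∧ T₂.card ≤ (3 * n + 6) / 7 ∧
      3 ≤ ((σ ⟨n - 4, by omega⟩) ∩ (T₁ ∪ T₂)).card := by
  obtain ⟨m, rfl⟩ : ∃ m, n = m + 4 := ⟨n - 4, by omega⟩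
  have hm : m + 4 - 3 = m + 1 := by omega
  choose x y hy hs hx using fun k hk => structure_step σ hB hP k hk
  let s : ℕ → Finset ℕ := fun i => if h : i < m + 4 - 3 then σ ⟨i, h⟩ else ∅
  let X : ℕ → ℕ := fun i => if h : (i - 1) + 1 < m + 4 - 3 then x (i - 1) h else 0
  let Y : ℕ → ℕ := fun i => if h : i + 1 < m + 4 - 3 then y i h else 0
  have sσ : ∀ i (h : i < m + 4 - 3), s i = σ ⟨i, h⟩ := fun i h => by
    simp only [s, h, dite_true]
  have XX : ∀ k (h : k + 1 < m + 4 - 3), X (k + 1) = x k h := fun k h => by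
    simp only [X, Nat.add_sub_cancel, h, dite_true]
  have YY : ∀ k (h : k + 1 < m + 4 - 3), Y k = y k h := fun k h => by
    simp only [Y, h, dite_true]
  have hxy : ∀ k, k + 2 < m + 4 - 3 → Y (k + 1) ≠ X (k + 1) := by
    intro k hk heq
    have h1 : k + 1 < m + 4 - 3 := by omega
    rw [YY (k + 1) hk, XX k h1] at heq
    have hyk := hy k h1
    have hsk := hs k h1
    have hsk2 := hs (k + 1) hk
    have hxk : x k h1 ∉ σ ⟨k, by omega⟩ := hx k h1 ⟨k, by omega⟩ le_rfl
    have hxk2 : x (k + 1) hk ∉ σ ⟨k, by omega⟩ := hx (k + 1) hk ⟨k, by omega⟩ (by simp)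
    rw [heq, hsk, Finset.erase_insert (fun h => hxk (Finset.mem_of_mem_erase h))] at hsk2
    have hcard : (σ ⟨k, by omega⟩ ∩ σ ⟨k + 2, hk⟩).card = 3 := by
      have : σ ⟨k, by omega⟩ ∩ σ ⟨k + 2, hk⟩ = (σ ⟨k, by omega⟩).erase (y k h1) := by
        rw [show σ ⟨k + 2, hk⟩ = _ from hsk2, Finset.inter_insert_of_notMem hxk2]
        exact Finset.inter_eq_right.2 (Finset.erase_subset _ _)
      rw [this, Finset.card_erase_of_mem hyk, hB.1]
    have := (hP ⟨k, by omega⟩ ⟨k + 2, hk⟩).1 ⟨by simp, hcard⟩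
    simp only at this
    omega
  obtain ⟨v, -, hG⟩ := main_ind s (m + 4 - 3)
    (fun k hk => by rw [sσ k hk]; exact hB.1 _) X Y
    (fun k hk => by rw [sσ k (by omega), YY k hk]; exact hy k hk)
    (fun k hk => by rw [sσ k (by omega), sσ (k + 1) hk, YY k hk, XX k hk]; exact hs k hk)
    (fun k hk i hi => by rw [sσ i (by omega), XX k hk]; exact hx k hk ⟨i, by omega⟩ hi)
    hxy m (by omega)
  obtain ⟨T₁, T₂, t1, t2, c1, c2, c3⟩ := G_final (Nat.mod_lt _ (by omega)) hG
    (by rw [sσ m (by omega)]; exact hB.1 _)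
  have tr : ∀ T : Finset ℕ, (∀ f : Finset ℕ, f.card = 3 → ∀ i, i ≤ m → f ⊆ s i →
        (∀ j, j ≤ m → j ≠ i → ¬ f ⊆ s j) → (T ∩ f).Nonempty) →
      IsTransversal T (sphereFacets 2 (m + 4 - 3) σ) := by
    rintro T hT f ⟨hf, i, hi, hu⟩
    refine hT f hf i.val (by omega) (by rw [sσ i.val i.isLt]; exact hi) ?_
    intro j hj hne hfj
    rw [sσ j (by omega)] at hfj
    exact hne (congrArg Fin.val (hu ⟨j, by omega⟩ hfj))
  refine ⟨T₁, T₂, tr T₁ t1, tr T₂ t2, c1, c2, ?_⟩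
  rw [sσ m (by omega)] at c3
  exact c3
end
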